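/- arXiv:1307.6893 — 2 statements merged into one kernel-verified Lean document; each statement's English description precedes it below -/
import Mathlib

section
/- Let n ≥ 3, G = SL(n,ℝ), Γ the image of SL(n,ℤ) in G, and let a : ℝ → G be a nontrivial continuous one-parameter subgroup such that each matrix a(t) is diagonalizable over ℝ. Then there exists g ∈ G such that the orbit t ↦ a(t)g·(eΓ) tends to the cocompact filter of G/Γ as t → +∞ (it diverges to infinity), and yet there do NOT exist an integer ℓ ≥ 1, a continuous group homomorphism ρ : G → SL(ℓ,ℝ) with ρ(Γ) contained in the image of SL(ℓ,ℤ), and a nonzero integer vector v ∈ ℤ^ℓ, such that ρ(a(t)g)·v → 0 in ℝ^ℓ as t → +∞. -/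
open Matrix MatrixGroups Filter Topology

noncomputable instance {n : ℕ} : TopologicalSpace (Matrix.SpecialLinearGroup (Fin n) ℝ) :=
  instTopologicalSpaceSubtype

/-- The image of `SL(n,ℤ)` in `SL(n,ℝ)`. -/
def SLZ (n : ℕ) : Subgroup (SL(n, ℝ)) :=
  (Matrix.SpecialLinearGroup.map (n := Fin n) (Int.castRingHom ℝ)).range

namespace Dani

noncomputable instance instTG {n : ℕ} : IsTopologicalGroup SL(n, ℝ) :=
  Matrix.SpecialLinearGroup.topologicalGroup

instance instT2 {n : ℕ} : T2Space SL(n, ℝ) :=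
  inferInstanceAs (T2Space (Subtype _))

instance instLC {n : ℕ} : LocallyCompactSpace SL(n, ℝ) := by
  have : LocallyCompactSpace (Matrix (Fin n) (Fin n) ℝ) :=
    inferInstanceAs (LocallyCompactSpace (Fin n → Fin n → ℝ))
  exact Matrix.SpecialLinearGroup.isClosedEmbedding_val.locallyCompactSpace

theorem cont_val {n : ℕ} : Continuous fun g : SL(n, ℝ) => g.1 := continuous_subtype_val

theorem cont_mulVec {n : ℕ} (v : Fin n → ℝ) : Continuous fun g : SL(n, ℝ) => g.1 *ᵥ v :=
  Continuous.matrix_mulVec cont_val continuous_const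

theorem mul_act {n : ℕ} (g h : SL(n, ℝ)) (v : Fin n → ℝ) :
    (g * h).1 *ᵥ v = g.1 *ᵥ (h.1 *ᵥ v) := by
  rw [Matrix.mulVec_mulVec]; rfl

theorem one_act {n : ℕ} (v : Fin n → ℝ) : (1 : SL(n, ℝ)).1 *ᵥ v = v := by
  show (1 : Matrix (Fin n) (Fin n) ℝ) *ᵥ v = v
  exact Matrix.one_mulVec v

theorem inv_act {n : ℕ} (g : SL(n, ℝ)) (v : Fin n → ℝ) :
    (g⁻¹).1 *ᵥ (g.1 *ᵥ v) = v := by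
  rw [← mul_act, inv_mul_cancel, one_act]

theorem act_inv {n : ℕ} (g : SL(n, ℝ)) (v : Fin n → ℝ) :
    g.1 *ᵥ ((g⁻¹).1 *ᵥ v) = v := by
  rw [← mul_act, mul_inv_cancel, one_act]

theorem act_ne {n : ℕ} (g : SL(n, ℝ)) {v : Fin n → ℝ} (hv : v ≠ 0) : g.1 *ᵥ v ≠ 0 := by
  intro h
  apply hv
  rw [← inv_act g v, h, Matrix.mulVec_zero]

/-- inverse transpose -/
noncomputable def th {n : ℕ} : SL(n, ℝ) →* SL(n, ℝ) where
  toFun g := (g⁻¹).transpose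
  map_one' := by
    apply Subtype.ext; simp
  map_mul' g h := by
    apply Subtype.ext
    rw [_root_.mul_inv_rev]
    exact Matrix.transpose_mul (h⁻¹).1 (g⁻¹).1

theorem th_val {n : ℕ} (g : SL(n, ℝ)) : (th g).1 = (g⁻¹).1ᵀ := rfl

theorem th_th {n : ℕ} (g : SL(n, ℝ)) : th (th g) = g := by
  apply Subtype.ext
  rw [th_val, ← map_inv, th_val, inv_inv, Matrix.transpose_transpose]

theorem cont_th {n : ℕ} : Continuous (th : SL(n, ℝ) → SL(n, ℝ)) := by
  refine continuous_induced_rng.mpr ?_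
  exact (cont_val.comp continuous_inv).matrix_transpose

theorem th_dot {n : ℕ} (g : SL(n, ℝ)) (w v : Fin n → ℝ) :
    ((th g).1 *ᵥ w) ⬝ᵥ (g.1 *ᵥ v) = w ⬝ᵥ v := by
  rw [th_val, Matrix.mulVec_transpose, ← Matrix.dotProduct_mulVec, inv_act]

theorem th_dot' {n : ℕ} (g : SL(n, ℝ)) (w v : Fin n → ℝ) :
    (g.1 *ᵥ w) ⬝ᵥ ((th g).1 *ᵥ v) = w ⬝ᵥ v := by
  rw [dotProduct_comm, th_dot, dotProduct_comm]

theorem det_one_add_vmv {n : ℕ} (u φ : Fin n → ℝ) : (1 + vecMulVec u φ).det = 1 + φ ⬝ᵥ u := by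
  rw [Matrix.vecMulVec_eq Unit, Matrix.det_one_add_replicateCol_mul_replicateRow]

/-- transvections -/
noncomputable def tv {n : ℕ} (u φ : Fin n → ℝ) (h : φ ⬝ᵥ u = 0) : SL(n, ℝ) :=
  ⟨1 + vecMulVec u φ, by rw [det_one_add_vmv, h, add_zero]⟩

theorem tv_val {n : ℕ} (u φ : Fin n → ℝ) (h : φ ⬝ᵥ u = 0) : (tv u φ h).1 = 1 + vecMulVec u φ := rfl

theorem vmv_act {n : ℕ} (u φ x : Fin n → ℝ) : vecMulVec u φ *ᵥ x = (φ ⬝ᵥ x) • u := by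
  rw [Matrix.vecMulVec_mulVec, op_smul_eq_smul]

theorem tv_act {n : ℕ} (u φ : Fin n → ℝ) (h : φ ⬝ᵥ u = 0) (x : Fin n → ℝ) :
    (tv u φ h).1 *ᵥ x = x + (φ ⬝ᵥ x) • u := by
  rw [tv_val, Matrix.add_mulVec, Matrix.one_mulVec, vmv_act]

theorem SL_ext {n : ℕ} {g h : SL(n, ℝ)} (H : ∀ x : Fin n → ℝ, g.1 *ᵥ x = h.1 *ᵥ x) : g = h := by
  apply Subtype.ext
  apply Matrix.mulVec_injective
  funext x
  exact H x

theorem tv_mul {n : ℕ} (u u' φ : Fin n → ℝ) (h : φ ⬝ᵥ u = 0) (h' : φ ⬝ᵥ u' = 0) :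
    tv u φ h * tv u' φ h' = tv (u + u') φ (by rw [dotProduct_add, h, h', add_zero]) := by
  apply SL_ext
  intro x
  rw [mul_act, tv_act, tv_act, tv_act, dotProduct_add, dotProduct_smul, h']
  simp [smul_add]; abel

theorem tv_mul' {n : ℕ} (u φ φ' : Fin n → ℝ) (h : φ ⬝ᵥ u = 0) (h' : φ' ⬝ᵥ u = 0) :
    tv u φ h * tv u φ' h' = tv u (φ + φ') (by rw [add_dotProduct, h, h', add_zero]) := by
  apply SL_ext
  intro x
  rw [mul_act, tv_act, tv_act, tv_act, dotProduct_add, dotProduct_smul, h]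
  simp [add_dotProduct, add_smul]; abel

theorem tv_zero {n : ℕ} (φ : Fin n → ℝ) (h : φ ⬝ᵥ (0 : Fin n → ℝ) = 0) : tv 0 φ h = 1 := by
  apply SL_ext
  intro x
  rw [tv_act, one_act]; simp

theorem tv_zero' {n : ℕ} (u : Fin n → ℝ) (h : (0 : Fin n → ℝ) ⬝ᵥ u = 0) : tv u 0 h = 1 := by
  apply SL_ext
  intro x
  rw [tv_act, one_act]; simp

theorem tv_pow {n : ℕ} (u φ : Fin n → ℝ) (h : φ ⬝ᵥ u = 0) (m : ℕ) :
    tv u φ h ^ m = tv ((m : ℝ) • u) φ (by rw [dotProduct_smul, h, smul_zero]) := by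
  induction m with
  | zero => 
    rw [pow_zero]
    apply SL_ext
    intro x
    rw [tv_act, one_act]; simp
  | succ k ih =>
    rw [pow_succ, ih, tv_mul]
    apply SL_ext
    intro x
    rw [tv_act, tv_act]
    push_cast
    rw [add_smul, one_smul]

theorem tv_inv {n : ℕ} (u φ : Fin n → ℝ) (h : φ ⬝ᵥ u = 0) :
    (tv u φ h)⁻¹ = tv (-u) φ (by rw [dotProduct_neg, h, neg_zero]) := by
  rw [inv_eq_iff_mul_eq_one, tv_mul]
  apply SL_ext
  intro x
  rw [tv_act, one_act]; simp

theorem tv_conj {n : ℕ} (k : SL(n, ℝ)) (u φ : Fin n → ℝ) (h : φ ⬝ᵥ u = 0) :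
    k * tv u φ h * k⁻¹ = tv (k.1 *ᵥ u) ((th k).1 *ᵥ φ) (by rw [th_dot, h]) := by
  apply SL_ext
  intro x
  obtain ⟨y, rfl⟩ : ∃ y, x = k.1 *ᵥ y := ⟨_, (act_inv k x).symm⟩
  rw [mul_act, mul_act, inv_act, tv_act, tv_act, th_dot, Matrix.mulVec_add, Matrix.mulVec_smul]

theorem th_tv {n : ℕ} (u φ : Fin n → ℝ) (h : φ ⬝ᵥ u = 0) :
    th (tv u φ h) = tv φ (-u) (by rw [neg_dotProduct, dotProduct_comm, h, neg_zero]) := by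
  apply Subtype.ext
  rw [th_val, tv_inv, tv_val, tv_val, Matrix.transpose_add, Matrix.transpose_one,
    Matrix.transpose_vecMulVec]

theorem cont_tv {n : ℕ} {X : Type*} [TopologicalSpace X] (u φ : X → Fin n → ℝ)
    (h : ∀ x, φ x ⬝ᵥ u x = 0) (hu : Continuous u) (hφ : Continuous φ) :
    Continuous fun x => tv (u x) (φ x) (h x) := by
  refine continuous_induced_rng.mpr ?_
  exact continuous_const.add (hu.matrix_vecMulVec hφ)

/-- separate -/
theorem exists_phi {n : ℕ} (F : Submodule ℝ (Fin n → ℝ)) {y : Fin n → ℝ} (hy : y ∉ F) :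
    ∃ φ : Fin n → ℝ, φ ⬝ᵥ y = 1 ∧ ∀ f ∈ F, φ ⬝ᵥ f = 0 := by
  obtain ⟨f, hf, hF⟩ := Submodule.exists_le_ker_of_notMem hy
  have key : ∀ x, (fun i => (f y)⁻¹ * f (Pi.single i 1)) ⬝ᵥ x = (f y)⁻¹ * f x := by
    intro x
    conv_rhs => rw [pi_eq_sum_univ' x, map_sum, Finset.mul_sum]
    simp only [dotProduct]
    refine Finset.sum_congr rfl fun i _ => ?_
    rw [map_smul, smul_eq_mul]; ring_nf
  refine ⟨fun i => (f y)⁻¹ * f (Pi.single i 1), ?_, ?_⟩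
  · rw [key, inv_mul_cancel₀ hf]
  · intro x hx
    rw [key, LinearMap.mem_ker.mp (hF hx), mul_zero]

end Dani

namespace Dani

theorem move_phi {n : ℕ} (F : Submodule ℝ (Fin n → ℝ)) {y z : Fin n → ℝ}
    (h : y ∉ F ⊔ Submodule.span ℝ {y - z}) :
    ∃ φ : Fin n → ℝ, φ ⬝ᵥ y = 1 ∧ φ ⬝ᵥ z = 1 ∧ φ ⬝ᵥ (y - z) = 0 ∧ ∀ f ∈ F, φ ⬝ᵥ f = 0 := by
  obtain ⟨φ, h1, h2⟩ := exists_phi _ h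
  have h3 : φ ⬝ᵥ (y - z) = 0 :=
    h2 _ (Submodule.mem_sup_right (Submodule.mem_span_singleton_self _))
  refine ⟨φ, h1, ?_, h3, fun f hf => h2 f (Submodule.mem_sup_left hf)⟩
  rw [dotProduct_sub] at h3
  linarith

/-- transvections fixing `F` pointwise -/
def TS {n : ℕ} (F : Submodule ℝ (Fin n → ℝ)) : Set SL(n, ℝ) :=
  {g | ∃ u φ h, g = tv u φ h ∧ ∀ f ∈ F, φ ⬝ᵥ f = 0}

/-- pointwise fixator -/
def Fx {n : ℕ} (F : Submodule ℝ (Fin n → ℝ)) : Subgroup SL(n, ℝ) where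
  carrier := {g | ∀ f ∈ F, g.1 *ᵥ f = f}
  one_mem' := fun f _ => one_act f
  mul_mem' := by
    intro a b ha hb f hf
    rw [mul_act, hb f hf, ha f hf]
  inv_mem' := by
    intro a ha f hf
    conv_lhs => rw [← ha f hf]
    exact inv_act a f

theorem TS_sub {n : ℕ} (F : Submodule ℝ (Fin n → ℝ)) : TS F ⊆ (Fx F : Set SL(n, ℝ)) := by
  rintro g ⟨u, φ, h, rfl, hF⟩ f hf
  rw [tv_act, hF f hf, zero_smul, add_zero]

theorem move1 {n : ℕ} (F : Submodule ℝ (Fin n → ℝ)) {y z : Fin n → ℝ}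
    (h : y ∉ F ⊔ Submodule.span ℝ {y - z}) : ∃ g ∈ TS F, g.1 *ᵥ z = y := by
  obtain ⟨φ, h1, h2, h3, h4⟩ := move_phi F h
  refine ⟨tv (y - z) φ h3, ⟨_, _, _, rfl, h4⟩, ?_⟩
  rw [tv_act, h2]; simp

theorem move2 {n : ℕ} (F : Submodule ℝ (Fin n → ℝ)) {y z : Fin n → ℝ} (hy : y ∉ F) (hz : z ∉ F)
    (hF : F ⊔ Submodule.span ℝ {y} ≠ ⊤) : ∃ g ∈ Subgroup.closure (TS F), g.1 *ᵥ z = y := by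
  by_cases h : y ∉ F ⊔ Submodule.span ℝ {y - z}
  · obtain ⟨g, hg, e⟩ := move1 F h
    exact ⟨g, Subgroup.subset_closure hg, e⟩
  · push Not at h
    obtain ⟨x, hx⟩ : ∃ x, x ∉ F ⊔ Submodule.span ℝ {y} := by
      by_contra! H
      exact hF (eq_top_iff.mpr fun x _ => H x)
    have hsp : ∀ f ∈ F, ∀ c : ℝ, f + c • y ∈ F ⊔ Submodule.span ℝ {y} := fun f hf c =>
      Submodule.add_mem_sup hf (Submodule.smul_mem _ _ (Submodule.mem_span_singleton_self _))
    have hzy : ∃ f ∈ F, ∃ d : ℝ, z = f + d • y := by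
      obtain ⟨f, hf, s, hs, e⟩ := Submodule.mem_sup.mp h
      obtain ⟨c, rfl⟩ := Submodule.mem_span_singleton.mp hs
      have hc : c ≠ 0 := by
        rintro rfl
        apply hy; rw [← e]; simpa using hf
      refine ⟨c⁻¹ • f, F.smul_mem _ hf, 1 - c⁻¹, ?_⟩
      have : c • z = f + (c - 1) • y := by
        rw [sub_smul, one_smul]
        nth_rewrite 2 [← e]
        rw [smul_sub]; abel
      rw [← inv_smul_smul₀ hc z, this, smul_add, smul_smul]
      congr 2
      field_simp
    have h1 : y ∉ F ⊔ Submodule.span ℝ {y - x} := by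
      intro H
      obtain ⟨f, hf, s, hs, e⟩ := Submodule.mem_sup.mp H
      obtain ⟨c, rfl⟩ := Submodule.mem_span_singleton.mp hs
      have hc : c ≠ 0 := by
        rintro rfl
        apply hy; rw [← e]; simpa using hf
      apply hx
      have : x = c⁻¹ • f + (1 - c⁻¹) • y := by
        have : c • x = f + (c - 1) • y := by
          rw [sub_smul, one_smul]
          nth_rewrite 2 [← e]
          rw [smul_sub]; abel
        rw [← inv_smul_smul₀ hc x, this, smul_add, smul_smul]
        congr 2
        field_simp
      rw [this]
      exact hsp _ (F.smul_mem _ hf) _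
    have h2 : x ∉ F ⊔ Submodule.span ℝ {x - z} := by
      intro H
      obtain ⟨f, hf, s, hs, e⟩ := Submodule.mem_sup.mp H
      obtain ⟨c, rfl⟩ := Submodule.mem_span_singleton.mp hs
      have e2 : (1 - c) • x = f - c • z := by
        rw [sub_smul, one_smul]
        nth_rewrite 1 [← e]
        rw [smul_sub]; abel
      by_cases hc : c = 1
      · subst hc
        apply hz
        rw [sub_self, zero_smul, one_smul] at e2
        rw [← sub_eq_zero.mp e2.symm]; exact hf
      · obtain ⟨f', hf', d, rfl⟩ := hzy
        apply hx
        have hc' : (1 - c) ≠ 0 := sub_ne_zero.mpr (Ne.symm hc)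
        rw [← inv_smul_smul₀ hc' x, e2]
        apply Submodule.smul_mem
        have : f - c • (f' + d • y) = (f - c • f') + (-(c * d)) • y := by
          rw [smul_add, smul_smul, neg_smul]; abel
        rw [this]
        exact hsp _ (F.sub_mem hf (F.smul_mem _ hf')) _
    obtain ⟨g1, hg1, e1⟩ := move1 F h1
    obtain ⟨g2, hg2, e2⟩ := move1 F h2
    refine ⟨g1 * g2, mul_mem (Subgroup.subset_closure hg1) (Subgroup.subset_closure hg2), ?_⟩
    rw [mul_act, e2, e1]

theorem gen_fix {n : ℕ} (k : ℕ) : ∀ (F : Submodule ℝ (Fin n → ℝ)), n - Module.finrank ℝ F ≤ k →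
    Fx F ≤ Subgroup.closure (TS F) := by
  induction k with
  | zero =>
    intro F hF g hg
    have h1 : Module.finrank ℝ F = Module.finrank ℝ (Fin n → ℝ) := by
      have := Submodule.finrank_le F
      simp at this ⊢
      omega
    have h2 := Submodule.eq_top_of_finrank_eq h1
    have : g = 1 := SL_ext fun x => by rw [one_act]; exact hg x (h2 ▸ Submodule.mem_top)
    rw [this]; exact one_mem _
  | succ k ih =>
    intro F hF g hg
    by_cases hT : F = ⊤
    · have : g = 1 := SL_ext fun x => by rw [one_act]; exact hg x (hT ▸ Submodule.mem_top)
      rw [this]; exact one_mem _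
    obtain ⟨y, hy⟩ : ∃ y, y ∉ F := by
      by_contra! H
      exact hT (eq_top_iff.mpr fun x _ => H x)
    by_cases hF' : F ⊔ Submodule.span ℝ {y} = ⊤
    · obtain ⟨φ, h1, h2⟩ := exists_phi F hy
      have hx : ∀ x, g.1 *ᵥ x = x + (φ ⬝ᵥ x) • (g.1 *ᵥ y - y) := by
        intro x
        have : x ∈ F ⊔ Submodule.span ℝ {y} := hF' ▸ Submodule.mem_top
        obtain ⟨f, hf, s, hs, rfl⟩ := Submodule.mem_sup.mp this
        obtain ⟨c, rfl⟩ := Submodule.mem_span_singleton.mp hs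
        rw [Matrix.mulVec_add, Matrix.mulVec_smul, hg f hf, dotProduct_add, h2 f hf,
          dotProduct_smul, h1, smul_sub]
        simp
      have hval : g.1 = 1 + vecMulVec (g.1 *ᵥ y - y) φ := by
        apply Matrix.mulVec_injective
        funext x
        rw [hx x, Matrix.add_mulVec, Matrix.one_mulVec, vmv_act]
      have h0 : φ ⬝ᵥ (g.1 *ᵥ y - y) = 0 := by
        have := g.2
        rw [hval, det_one_add_vmv] at this
        linarith
      apply Subgroup.subset_closure
      refine ⟨_, φ, h0, ?_, h2⟩
      apply SL_ext
      intro x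
      rw [tv_act, hx x]
    · have hgy : g.1 *ᵥ y ∉ F := by
        intro H
        apply hy
        have := hg _ H
        have h2 : g.1 *ᵥ y = y := by
          rw [← inv_act g (g.1 *ᵥ y), this, inv_act]
        rwa [← h2]
      obtain ⟨t, ht, e⟩ := move2 F hy hgy hF'
      have htF : t ∈ Fx F := (Subgroup.closure_le _).mpr (TS_sub F) ht
      have hlt : F < F ⊔ Submodule.span ℝ {y} := by
        refine lt_of_le_of_ne le_sup_left fun H => hy ?_
        rw [H]
        exact Submodule.mem_sup_right (Submodule.mem_span_singleton_self _)
      have h1 := Submodule.finrank_lt_finrank_of_lt hlt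
      have h2 : t * g ∈ Subgroup.closure (TS (F ⊔ Submodule.span ℝ {y})) := by
        apply ih
        · omega
        · intro x hx
          obtain ⟨f, hf, s, hs, rfl⟩ := Submodule.mem_sup.mp hx
          obtain ⟨c, rfl⟩ := Submodule.mem_span_singleton.mp hs
          rw [mul_act, Matrix.mulVec_add, Matrix.mulVec_smul, hg f hf, Matrix.mulVec_add,
            Matrix.mulVec_smul, e, htF f hf]
      have h3 : t * g ∈ Subgroup.closure (TS F) := by
        refine Subgroup.closure_mono ?_ h2
        rintro _ ⟨u, φ, h, rfl, hh⟩
        exact ⟨u, φ, h, rfl, fun f hf => hh f (Submodule.mem_sup_left hf)⟩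
      have : g = t⁻¹ * (t * g) := by group
      rw [this]
      exact mul_mem (inv_mem ht) h3

theorem fix_eq {n : ℕ} (F : Submodule ℝ (Fin n → ℝ)) : Fx F ≤ Subgroup.closure (TS F) :=
  gen_fix n F (Nat.sub_le _ _)

/-- generated by every neighbourhood of 1 -/
def NG {n : ℕ} (S : Subgroup SL(n, ℝ)) : Prop :=
  ∀ V ∈ 𝓝 (1 : SL(n, ℝ)), S ≤ Subgroup.closure ((S : Set SL(n, ℝ)) ∩ V)

theorem tv_tendsto {n : ℕ} (u φ : Fin n → ℝ) (h : φ ⬝ᵥ u = 0) :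
    Tendsto (fun s : ℝ => tv (s • u) φ (by rw [dotProduct_smul, h, smul_zero])) (𝓝 0)
      (𝓝 (1 : SL(n, ℝ))) := by
  have := (cont_tv (fun s : ℝ => s • u) (fun _ => φ) (fun s => by rw [dotProduct_smul, h, smul_zero])
    (by fun_prop) continuous_const).tendsto 0
  convert this using 2
  apply SL_ext; intro x
  rw [tv_act, one_act]; simp

theorem NG_fix {n : ℕ} (F : Submodule ℝ (Fin n → ℝ)) : NG (Fx F) := by
  intro V hV
  refine (fix_eq F).trans ((Subgroup.closure_le _).mpr ?_)
  rintro _ ⟨u, φ, h, rfl, hF⟩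
  have h1 : Tendsto (fun m : ℕ => ((m : ℝ) + 1)⁻¹) atTop (𝓝 0) := by
    simpa [one_div] using tendsto_one_div_add_atTop_nhds_zero_nat (𝕜 := ℝ)
  obtain ⟨m, hm⟩ := (((tv_tendsto u φ h).comp h1).eventually hV).exists
  have : tv u φ h = (tv (((m : ℝ) + 1)⁻¹ • u) φ (by rw [dotProduct_smul, h, smul_zero])) ^ (m + 1) := by
    rw [tv_pow]
    apply SL_ext; intro x
    rw [tv_act, tv_act]
    push_cast
    rw [smul_inv_smul₀ (by positivity)]
  rw [this]
  apply pow_mem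
  apply Subgroup.subset_closure
  exact ⟨TS_sub F ⟨_, _, _, rfl, hF⟩, hm⟩

/-- vector stabilizer twisted by `τ` -/
def St {n : ℕ} (τ : SL(n, ℝ) →* SL(n, ℝ)) (v : Fin n → ℝ) : Subgroup SL(n, ℝ) :=
  (Fx (Submodule.span ℝ {v})).comap τ

theorem mem_St {n : ℕ} (τ : SL(n, ℝ) →* SL(n, ℝ)) (v : Fin n → ℝ) (g : SL(n, ℝ)) :
    g ∈ St τ v ↔ (τ g).1 *ᵥ v = v := by
  constructor
  · intro h
    exact h v (Submodule.mem_span_singleton_self v)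
  · intro h f hf
    obtain ⟨c, rfl⟩ := Submodule.mem_span_singleton.mp hf
    rw [Matrix.mulVec_smul, h]

theorem NG_St {n : ℕ} (τ : SL(n, ℝ) →* SL(n, ℝ)) (hτ : Continuous τ) (hi : ∀ g, τ (τ g) = g)
    (v : Fin n → ℝ) : NG (St τ v) := by
  intro V hV g hg
  have hV' : τ ⁻¹' V ∈ 𝓝 (1 : SL(n, ℝ)) := hτ.continuousAt.preimage_mem_nhds (by rwa [map_one])
  have h1 := NG_fix (Submodule.span ℝ {v}) _ hV' (show τ g ∈ _ from hg)
  have h2 : τ (τ g) ∈ (Subgroup.closure _).map τ := Subgroup.mem_map_of_mem τ h1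
  rw [hi, MonoidHom.map_closure] at h2
  refine Subgroup.closure_mono ?_ h2
  rintro _ ⟨x, ⟨hx, hxV⟩, rfl⟩
  refine ⟨?_, hxV⟩
  show τ (τ x) ∈ Fx (Submodule.span ℝ {v})
  rw [hi]; exact hx

theorem NG_top {n : ℕ} : NG (⊤ : Subgroup SL(n, ℝ)) := by
  have : (⊤ : Subgroup SL(n, ℝ)) = Fx ⊥ := by
    refine le_antisymm ?_ le_top
    intro g _ f hf
    rw [(Submodule.mem_bot ℝ).mp hf, Matrix.mulVec_zero]
  rw [this]; exact NG_fix _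

/-- The continuation lemma. -/
theorem cont_ext {n l : ℕ} (S : Subgroup SL(n, ℝ)) (hS : NG S) (ρ : SL(n, ℝ) →* SL(l, ℝ))
    (E : Submodule ℝ (Fin l → ℝ)) (x : Fin l → ℝ)
    (h : ∃ V ∈ 𝓝 (1 : SL(n, ℝ)), ∀ g ∈ S, g ∈ V → (ρ g).1 *ᵥ x ∈ E) :
    ∀ g ∈ S, (ρ g).1 *ᵥ x ∈ E := by
  let W : Submodule ℝ (Fin l → ℝ) :=
    { carrier := {y | ∃ V ∈ 𝓝 (1 : SL(n, ℝ)), ∀ g ∈ S, g ∈ V → (ρ g).1 *ᵥ y ∈ E}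
      zero_mem' := ⟨Set.univ, univ_mem, fun g _ _ => by rw [Matrix.mulVec_zero]; exact E.zero_mem⟩
      add_mem' := by
        rintro a b ⟨V, hV, h1⟩ ⟨V', hV', h2⟩
        refine ⟨V ∩ V', inter_mem hV hV', fun g hg hgV => ?_⟩
        rw [Matrix.mulVec_add]
        exact E.add_mem (h1 g hg hgV.1) (h2 g hg hgV.2)
      smul_mem' := by
        rintro c a ⟨V, hV, h1⟩
        refine ⟨V, hV, fun g hg hgV => ?_⟩
        rw [Matrix.mulVec_smul]
        exact E.smul_mem _ (h1 g hg hgV) }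
  have hxW : x ∈ W := h
  have hWE : ∀ y ∈ W, y ∈ E := by
    rintro y ⟨V, hV, h1⟩
    have := h1 1 (one_mem _) (mem_of_mem_nhds hV)
    rwa [map_one, one_act] at this
  obtain ⟨V, hV, hVW⟩ : ∃ V ∈ 𝓝 (1 : SL(n, ℝ)), ∀ g ∈ S, g ∈ V → ∀ y ∈ W, (ρ g).1 *ᵥ y ∈ E := by
    obtain ⟨s, hs⟩ := (IsNoetherian.noetherian W : W.FG)
    have h1 : ∀ y : s, ∃ V ∈ 𝓝 (1 : SL(n, ℝ)), ∀ g ∈ S, g ∈ V → (ρ g).1 *ᵥ y.1 ∈ E := fun y => by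
      have : y.1 ∈ W := hs ▸ Submodule.subset_span y.2
      exact this
    choose V hV h2 using h1
    refine ⟨⋂ y, V y, (Filter.iInter_mem).mpr hV, fun g hg hgV y hy => ?_⟩
    rw [← hs] at hy
    induction hy using Submodule.span_induction with
    | mem y hy => exact h2 ⟨y, hy⟩ g hg (Set.mem_iInter.mp hgV _)
    | zero => rw [Matrix.mulVec_zero]; exact E.zero_mem
    | add a b _ _ ha hb => rw [Matrix.mulVec_add]; exact E.add_mem ha hb
    | smul c a _ ha => rw [Matrix.mulVec_smul]; exact E.smul_mem _ ha
  obtain ⟨O, hOV, hO, h1O⟩ := mem_nhds_iff.mp hV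
  have key : ∀ g ∈ S, g ∈ O → ∀ y ∈ W, (ρ g).1 *ᵥ y ∈ W := by
    intro g hg hgO y hy
    refine ⟨(fun k => k * g) ⁻¹' O, ?_, ?_⟩
    · refine (continuous_mul_const g).continuousAt.preimage_mem_nhds ?_
      rw [one_mul]
      exact hO.mem_nhds hgO
    · intro k hk hkO
      rw [← mul_act, ← map_mul]
      exact hVW _ (mul_mem hk hg) (hOV hkO) y hy
  have hO' : O ∩ (O)⁻¹ ∈ 𝓝 (1 : SL(n, ℝ)) :=
    inter_mem (hO.mem_nhds h1O) (inv_mem_nhds_one _ (hO.mem_nhds h1O))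
  have key2 : ∀ g ∈ S, (∀ y ∈ W, (ρ g).1 *ᵥ y ∈ W) ∧ (∀ y ∈ W, (ρ g⁻¹).1 *ᵥ y ∈ W) := by
    intro g hg
    have := hS _ hO' hg
    clear hg
    induction this using Subgroup.closure_induction with
    | mem g hg => exact ⟨key g hg.1 hg.2.1, key g⁻¹ (inv_mem hg.1) hg.2.2⟩
    | one => simp only [inv_one, map_one, one_act]; simp
    | mul a b _ _ ha hb =>
      refine ⟨fun y hy => ?_, fun y hy => ?_⟩
      · rw [map_mul, mul_act]; exact ha.1 _ (hb.1 _ hy)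
      · rw [_root_.mul_inv_rev, map_mul, mul_act]; exact hb.2 _ (ha.2 _ hy)
    | inv a _ ha => rw [inv_inv]; exact ⟨ha.2, ha.1⟩
  exact fun g hg => hWE _ ((key2 g hg).1 x hxW)

end Dani

namespace Dani

theorem exists_perp {n : ℕ} (hn : 3 ≤ n) (a b : Fin n → ℝ) :
    ∃ x : Fin n → ℝ, x ≠ 0 ∧ a ⬝ᵥ x = 0 ∧ b ⬝ᵥ x = 0 := by
  let f : (Fin n → ℝ) →ₗ[ℝ] (Fin 2 → ℝ) := Matrix.mulVecLin (Matrix.of ![a, b])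
  have hk : LinearMap.ker f ≠ ⊥ := by
    apply LinearMap.ker_ne_bot_of_finrank_lt
    simp; omega
  obtain ⟨x, hx, hx0⟩ := Submodule.exists_mem_ne_zero_of_ne_bot hk
  have hx' : Matrix.mulVec (Matrix.of ![a, b]) x = 0 := hx
  refine ⟨x, hx0, ?_, ?_⟩
  · simpa [Matrix.mulVec] using congrFun hx' 0
  · simpa [Matrix.mulVec] using congrFun hx' 1

theorem dot_self_ne {n : ℕ} {x : Fin n → ℝ} (hx : x ≠ 0) : x ⬝ᵥ x ≠ 0 := by
  intro h; exact hx (dotProduct_self_eq_zero.mp h)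

theorem th_tv_act {n : ℕ} (u φ : Fin n → ℝ) (h : φ ⬝ᵥ u = 0) (w : Fin n → ℝ) (hw : w ⬝ᵥ u = 0) :
    (th (tv u φ h)).1 *ᵥ w = w := by
  rw [th_tv, tv_act, neg_dotProduct, dotProduct_comm, hw]; simp

theorem trans_aux {n : ℕ} {v1 v2 w : Fin n → ℝ}
    (h1 : w ⬝ᵥ v1 = 0) (h2 : w ⬝ᵥ v2 = 0) (h : v2 ∉ Submodule.span ℝ {v2 - v1}) :
    ∃ h : SL(n, ℝ), (th h).1 *ᵥ w = w ∧ h.1 *ᵥ v1 = v2 := by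
  obtain ⟨φ, e1, e2, e3, -⟩ := move_phi ⊥ (y := v2) (z := v1) (by simpa using h)
  refine ⟨tv (v2 - v1) φ e3, th_tv_act _ _ _ _ (by rw [dotProduct_sub, h1, h2, sub_zero]), ?_⟩
  rw [tv_act, e2]; simp

theorem trans0 {n : ℕ} (hn : 3 ≤ n) {v1 v2 w : Fin n → ℝ} (hv1 : v1 ≠ 0) (hv2 : v2 ≠ 0)
    (h1 : w ⬝ᵥ v1 = 0) (h2 : w ⬝ᵥ v2 = 0) :
    ∃ h : SL(n, ℝ), (th h).1 *ᵥ w = w ∧ h.1 *ᵥ v1 = v2 := by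
  by_cases h : v2 ∈ Submodule.span ℝ {v2 - v1}
  · obtain ⟨c, hc⟩ := Submodule.mem_span_singleton.mp h
    obtain ⟨x, hx, hxw, hxv⟩ := exists_perp hn w v2
    have hc0 : c ≠ 0 := by rintro rfl; apply hv2; rw [← hc, zero_smul]
    have hx1 : v1 ⬝ᵥ x = 0 := by
      have := congrArg (fun y => y ⬝ᵥ x) hc
      simp only [smul_dotProduct, sub_dotProduct, hxv, smul_eq_mul, zero_sub] at this
      have : v1 ⬝ᵥ x = 0 := by
        rcases mul_eq_zero.mp this with h | h
        · exact absurd h hc0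
        · linarith
      exact this
    obtain ⟨k1, a1, b1⟩ := trans_aux (v1 := v1) (v2 := x) (w := w) h1 hxw (by
      intro H
      obtain ⟨d, hd⟩ := Submodule.mem_span_singleton.mp H
      have e := congrArg (fun y => y ⬝ᵥ x) hd
      simp only [smul_dotProduct, sub_dotProduct, hx1, smul_eq_mul, sub_zero] at e
      have hd1 : d = 1 := by
        have := dot_self_ne hx
        exact mul_right_cancel₀ this (by rw [e, one_mul])
      rw [hd1, one_smul] at hd
      exact hv1 (by simpa using hd))
    obtain ⟨k2, a2, b2⟩ := trans_aux (v1 := x) (v2 := v2) (w := w) hxw h2 (by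
      intro H
      obtain ⟨d, hd⟩ := Submodule.mem_span_singleton.mp H
      have e := congrArg (fun y => y ⬝ᵥ x) hd
      simp only [smul_dotProduct, sub_dotProduct, hxv, smul_eq_mul, zero_sub] at e
      have hd1 : d = 0 := by
        rcases mul_eq_zero.mp e with h | h
        · exact h
        · exact absurd (neg_eq_zero.mp h) (dot_self_ne hx)
      rw [hd1, zero_smul] at hd
      exact hv2 hd.symm)
    refine ⟨k2 * k1, ?_, ?_⟩
    · rw [map_mul, mul_act, a1, a2]
    · rw [mul_act, b1, b2]
  · exact trans_aux h1 h2 h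

theorem trans1 {n : ℕ} (hn : 3 ≤ n) {w1 w2 v : Fin n → ℝ} (hw1 : w1 ≠ 0) (hw2 : w2 ≠ 0)
    (h1 : w1 ⬝ᵥ v = 0) (h2 : w2 ⬝ᵥ v = 0) :
    ∃ h : SL(n, ℝ), h.1 *ᵥ v = v ∧ (th h).1 *ᵥ w1 = w2 := by
  obtain ⟨h, a, b⟩ := trans0 hn hw1 hw2 (by rwa [dotProduct_comm]) (by rwa [dotProduct_comm]) (w := v)
  exact ⟨th h, a, by rwa [th_th]⟩

/-- integer vector as real vector -/
def ic {n : ℕ} (v : Fin n → ℤ) : Fin n → ℝ := fun i => (v i : ℝ)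

theorem ic_ne {n : ℕ} {v : Fin n → ℤ} (hv : v ≠ 0) : ic v ≠ 0 := by
  intro h; apply hv; funext i
  have := congrFun h i
  simpa [ic] using this

theorem approx {n : ℕ} (y : Fin n → ℝ) (N : Set (Fin n → ℝ)) (hN : N ∈ 𝓝 y) :
    ∃ (m : Fin n → ℤ) (c : ℝ), c ≠ 0 ∧ c • ic m ∈ N := by
  obtain ⟨ε, hε, hb⟩ := Metric.mem_nhds_iff.mp hN
  obtain ⟨k, hk⟩ := exists_nat_one_div_lt hε
  have hk0 : (0 : ℝ) < (k : ℝ) + 1 := by positivity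
  refine ⟨fun i => ⌊((k : ℝ) + 1) * y i⌋, ((k : ℝ) + 1)⁻¹, by positivity, hb ?_⟩
  rw [Metric.mem_ball, dist_pi_lt_iff hε]
  intro i
  rw [Real.dist_eq, abs_lt]
  have h1 := Int.floor_le (((k : ℝ) + 1) * y i)
  have h2 := Int.lt_floor_add_one (((k : ℝ) + 1) * y i)
  simp only [ic, Pi.smul_apply, smul_eq_mul]
  rw [div_lt_iff₀ hk0] at hk
  rw [inv_mul_eq_div]
  constructor
  · rw [lt_sub_iff_add_lt, lt_div_iff₀ hk0]; nlinarith
  · rw [sub_lt_iff_lt_add, div_lt_iff₀ hk0]; nlinarith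

theorem dens {n : ℕ} {w : Fin n → ℤ} (hw : w ≠ 0) {v : Fin n → ℝ} (hv : v ≠ 0)
    (hwv : ic w ⬝ᵥ v = 0) (N : Set SL(n, ℝ)) (hN : N ∈ 𝓝 1) :
    ∃ (z : Fin n → ℤ) (k : SL(n, ℝ)) (c : ℝ), z ≠ 0 ∧ k ∈ N ∧ c ≠ 0 ∧ k.1 *ᵥ v = c • ic z ∧
      (th k).1 *ᵥ ic w = ic w := by
  obtain ⟨i0, hi0⟩ : ∃ i, w i ≠ 0 := by
    by_contra! H; exact hw (funext H)
  have hi0' : (w i0 : ℝ) ≠ 0 := by exact_mod_cast hi0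
  set φ : Fin n → ℝ := (v ⬝ᵥ v)⁻¹ • v with hφ
  have hφv : φ ⬝ᵥ v = 1 := by
    rw [hφ, smul_dotProduct, smul_eq_mul, inv_mul_cancel₀ (dot_self_ne hv)]
  have hpf : ∀ y, φ ⬝ᵥ (y - (φ ⬝ᵥ y) • v) = 0 := by
    intro y; rw [dotProduct_sub, dotProduct_smul, hφv]; simp
  let F : (Fin n → ℝ) → SL(n, ℝ) := fun y => tv (y - (φ ⬝ᵥ y) • v) φ (hpf y)
  have hF : Continuous F := by
    apply cont_tv
    · unfold dotProduct; fun_prop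
    · exact continuous_const
  have hF1 : F v = 1 := by
    apply SL_ext; intro x
    simp only [F]
    rw [tv_act, one_act, hφv]; simp
  let f : (Fin n → ℝ) → (Fin n → ℝ) := fun r => r - ((ic w ⬝ᵥ r) * (w i0 : ℝ)⁻¹) • Pi.single i0 1
  have hf : Continuous f := by
    simp only [f]; unfold dotProduct; fun_prop
  have hfv : f v = v := by simp [f, hwv]
  have hdc : Continuous fun y : Fin n → ℝ => φ ⬝ᵥ y := by unfold dotProduct; fun_prop
  have hG : ContinuousAt (fun r => F ((φ ⬝ᵥ f r)⁻¹ • f r)) v := by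
    apply hF.continuousAt.comp
    refine ContinuousAt.smul (f := fun r => (φ ⬝ᵥ f r)⁻¹) (g := f) ?_ ?_
    · apply ContinuousAt.inv₀
      · exact (hdc.comp hf).continuousAt
      · rw [hfv, hφv]; exact one_ne_zero
    · exact hf.continuousAt
  have ev1 : ∀ᶠ r in 𝓝 v, F ((φ ⬝ᵥ f r)⁻¹ • f r) ∈ N := by
    apply hG.preimage_mem_nhds
    rw [hfv, hφv, inv_one, one_smul, hF1]; exact hN
  have ev2 : ∀ᶠ r in 𝓝 v, φ ⬝ᵥ f r ≠ 0 := by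
    apply (hdc.comp hf).continuousAt.eventually_ne
    simp only [Function.comp]
    rw [hfv, hφv]; exact one_ne_zero
  obtain ⟨m, c, hc, h1, h2⟩ := approx v _ (ev1.and ev2)
  let z : Fin n → ℤ := fun i => w i0 * m i - (∑ j, w j * m j) * (Pi.single i0 1 : Fin n → ℤ) i
  have hz : f (c • ic m) = (c * (w i0 : ℝ)⁻¹) • ic z := by
    funext i
    have hsum : (((∑ j, w j * m j : ℤ)) : ℝ) = ic w ⬝ᵥ ic m := by
      push_cast; rfl
    have hs : (((Pi.single i0 1 : Fin n → ℤ) i : ℤ) : ℝ) = (Pi.single i0 1 : Fin n → ℝ) i := by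
      by_cases h : i = i0
      · subst h; simp
      · simp [h]
    simp only [f, ic, z, Pi.sub_apply, Pi.smul_apply, smul_eq_mul]
    rw [Int.cast_sub, Int.cast_mul, Int.cast_mul, hsum, hs]
    rw [dotProduct_smul, smul_eq_mul]
    field_simp
  have hwz : ic w ⬝ᵥ f (c • ic m) = 0 := by
    simp only [f]
    generalize c • ic m = r
    rw [dotProduct_sub, dotProduct_smul, dotProduct_single]
    simp only [smul_eq_mul, mul_one]
    rw [show ic w i0 = (w i0 : ℝ) from rfl, mul_assoc, inv_mul_cancel₀ hi0', mul_one, sub_self]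
  have hz0 : z ≠ 0 := by
    intro h
    apply h2
    rw [hz, h]
    simp [ic, dotProduct]
  refine ⟨z, _, (φ ⬝ᵥ f (c • ic m))⁻¹ * (c * (w i0 : ℝ)⁻¹), hz0, h1, ?_, ?_, ?_⟩
  · exact mul_ne_zero (inv_ne_zero h2) (mul_ne_zero hc (inv_ne_zero hi0'))
  · simp only [F]
    rw [tv_act, hφv, one_smul, dotProduct_smul, smul_eq_mul, inv_mul_cancel₀ h2, one_smul, ← smul_smul,
      ← hz]
    abel
  · apply th_tv_act
    rw [dotProduct_sub, dotProduct_smul, dotProduct_smul, hwz, hwv]; simp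

structure Tau {n : ℕ} (τ : SL(n, ℝ) →* SL(n, ℝ)) : Prop where
  cont : Continuous τ
  inv : ∀ g, τ (τ g) = g
  comm : ∀ g, τ (th g) = th (τ g)

theorem tau_id {n : ℕ} : Tau (MonoidHom.id SL(n, ℝ)) := ⟨continuous_id, fun _ => rfl, fun _ => rfl⟩
theorem tau_th {n : ℕ} : Tau (th : SL(n, ℝ) →* SL(n, ℝ)) := ⟨cont_th, th_th, fun _ => rfl⟩

theorem cont_ext' {n l : ℕ} (S : Subgroup SL(n, ℝ)) (hS : NG S) (ρ : SL(n, ℝ) →* SL(l, ℝ))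
    (E : Submodule ℝ (Fin l → ℝ)) (x : Fin l → ℝ) (p : SL(n, ℝ))
    (h : ∃ V ∈ 𝓝 (1 : SL(n, ℝ)), ∀ g ∈ S, g ∈ V → (ρ (p * g)).1 *ᵥ x ∈ E) :
    ∀ g ∈ S, (ρ (p * g)).1 *ᵥ x ∈ E := by
  have := cont_ext S hS ρ (E.comap (Matrix.mulVecLin (ρ p).1)) x (by
    obtain ⟨V, hV, h1⟩ := h
    refine ⟨V, hV, fun g hg hgV => ?_⟩
    have := h1 g hg hgV
    rw [map_mul, mul_act] at this
    exact this)
  intro g hg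
  rw [map_mul, mul_act]
  exact this g hg

set_option maxHeartbeats 1000000 in
theorem lemM {n l : ℕ} (τ : SL(n, ℝ) →* SL(n, ℝ)) (hτ : Tau τ) (ρ : SL(n, ℝ) →* SL(l, ℝ))
    (hρ : Continuous ρ) (E : Submodule ℝ (Fin l → ℝ)) (x : Fin l → ℝ) (p : SL(n, ℝ))
    {w : Fin n → ℤ} (hw : w ≠ 0) {v0 : Fin n → ℝ} (hv0 : v0 ≠ 0) (hwv : ic w ⬝ᵥ v0 = 0)
    (U : Set SL(n, ℝ)) (hU : U ∈ 𝓝 1)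
    (H : ∀ h, (th (τ h)).1 *ᵥ ic w = ic w → h ∈ U → ∀ (z : Fin n → ℤ) (c : ℝ), z ≠ 0 → c ≠ 0 →
      (τ h).1 *ᵥ ic z = c • v0 → (ρ (p * h)).1 *ᵥ x ∈ E) :
    ∀ h, (th (τ h)).1 *ᵥ ic w = ic w → (ρ (p * h)).1 *ᵥ x ∈ E := by
  obtain ⟨O, hOU, hO, h1O⟩ := mem_nhds_iff.mp hU
  have hEc : IsClosed (E : Set (Fin l → ℝ)) := E.closed_of_finiteDimensional
  have key : ∀ h, (th (τ h)).1 *ᵥ ic w = ic w → h ∈ O → (ρ (p * h)).1 *ᵥ x ∈ E := by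
    intro h hh hhO
    by_contra hcon
    let f : SL(n, ℝ) → SL(n, ℝ) := fun k => h * (τ k)⁻¹
    have hf : Continuous f := continuous_const.mul hτ.cont.inv
    have hf1 : f 1 = h := by simp [f]
    have hN : f ⁻¹' O ∩ {k | (ρ (p * f k)).1 *ᵥ x ∉ E} ∈ 𝓝 (1 : SL(n, ℝ)) := by
      refine inter_mem ((hO.preimage hf).mem_nhds (by simpa [hf1] using hhO)) ?_
      have : Continuous fun k => (ρ (p * f k)).1 *ᵥ x :=
        (cont_mulVec x).comp (hρ.comp (continuous_const.mul hf))
      refine (hEc.isOpen_compl.preimage this).mem_nhds ?_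
      simpa [hf1] using hcon
    have hdot : ic w ⬝ᵥ ((τ h)⁻¹).1 *ᵥ v0 = 0 := by
      rw [← th_dot (τ h), hh, act_inv, hwv]
    obtain ⟨z, k, c, hz, ⟨hk1, hk2⟩, hc, e1, e2⟩ :=
      dens hw (act_ne (τ h)⁻¹ hv0) hdot _ hN
    apply hk2
    refine H _ ?_ (hOU hk1) z c⁻¹ hz (inv_ne_zero hc) ?_
    · simp only [f]
      rw [map_mul, map_inv, hτ.inv, map_mul, map_inv, mul_act]
      conv_lhs => rw [← e2]
      rw [inv_act, hh]
    · simp only [f]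
      have : ic z = c⁻¹ • (k.1 *ᵥ ((τ h)⁻¹).1 *ᵥ v0) := by rw [e1, inv_smul_smul₀ hc]
      rw [this, map_mul, map_inv, hτ.inv, Matrix.mulVec_smul, mul_act, inv_act, act_inv]
  intro h hh
  refine cont_ext' (St (th.comp τ) (ic w)) (NG_St (th.comp τ) (cont_th.comp hτ.cont) ?_ _) ρ E x p
    ⟨O, hO.mem_nhds h1O, fun g hg hgO => key g ((mem_St _ _ _).mp hg) hgO⟩ h ((mem_St _ _ _).mpr hh)
  intro g
  simp only [MonoidHom.comp_apply]
  rw [hτ.comm, hτ.inv, th_th]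

theorem decomp {n : ℕ} (hn : 3 ≤ n) {v w0 : Fin n → ℝ} (hv : v ≠ 0) (hw : w0 ≠ 0)
    (h : w0 ⬝ᵥ v = 0) (g : SL(n, ℝ)) : ∃ q1 q2 q3 : SL(n, ℝ), g = q1 * q2 * q3 ∧ q1.1 *ᵥ v = v ∧
      (th q2).1 *ᵥ w0 = w0 ∧ q3.1 *ᵥ v = v := by
  obtain ⟨w', hw', a1, a2⟩ := exists_perp hn v (g.1 *ᵥ v)
  obtain ⟨k, b1, b2⟩ := trans1 hn hw' hw (v := v) (by rwa [dotProduct_comm]) h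
  have e : w0 ⬝ᵥ k.1 *ᵥ g.1 *ᵥ v = 0 := by
    rw [← b2, th_dot, dotProduct_comm, a2]
  obtain ⟨m, c1, c2⟩ := trans0 hn hv (act_ne k (act_ne g hv)) h e
  refine ⟨k⁻¹, m, m⁻¹ * k * g, by group, ?_, c1, ?_⟩
  · conv_lhs => rw [← b1]
    rw [inv_act]
  · rw [mul_act, mul_act, ← c2, inv_act]

theorem chain {n l : ℕ} (hn : 3 ≤ n) (E1 E2 : Submodule ℝ (Fin n → ℝ))
    (hE : ∀ y ∈ E2, ∀ z ∈ E1, y ⬝ᵥ z = 0) (hE2 : E2 ≠ ⊥) (ρ : SL(n, ℝ) →* SL(l, ℝ))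
    (hρ : Continuous ρ) (E : Submodule ℝ (Fin l → ℝ)) (x : Fin l → ℝ)
    (hZ : ∃ g, (ρ g).1 *ᵥ x ∉ E) {v : Fin n → ℤ} (hv : v ≠ 0) (U : Set SL(n, ℝ)) (hU : IsOpen U)
    (p : SL(n, ℝ)) (hpU : p ∈ U) (hpv : p.1 *ᵥ ic v ∈ E1) :
    ∃ w : Fin n → ℤ, w ≠ 0 ∧ ∃ p1 ∈ U, p1.1 *ᵥ ic v ∈ E1 ∧ (th p1).1 *ᵥ ic w ∈ E2 ∧
      ∀ U1 ∈ 𝓝 p1, ∃ v' : Fin n → ℤ, v' ≠ 0 ∧ ∃ p2 ∈ U1, (th p2).1 *ᵥ ic w ∈ E2 ∧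
        p2.1 *ᵥ ic v' ∈ E1 ∧ ∀ U2 ∈ 𝓝 p2, ∃ p3 ∈ U2, p3.1 *ᵥ ic v' ∈ E1 ∧ (ρ p3).1 *ᵥ x ∉ E := by
  by_contra! H
  obtain ⟨e2, he2, he20⟩ := Submodule.exists_mem_ne_zero_of_ne_bot hE2
  have conjfix : ∀ (q h : SL(n, ℝ)) (z v : Fin n → ℝ) (c : ℝ), q.1 *ᵥ v = v → h.1 *ᵥ z = c • v →
      (h⁻¹ * q * h).1 *ᵥ z = z := by
    intro q h z v c h1 h2
    rw [mul_act, mul_act, h2, Matrix.mulVec_smul, h1, ← h2, inv_act]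
  have step2 : ∀ w : Fin n → ℤ, w ≠ 0 → ∀ p1 ∈ U, p1.1 *ᵥ ic v ∈ E1 → (th p1).1 *ᵥ ic w ∈ E2 →
      ∀ q : SL(n, ℝ), q.1 *ᵥ ic v = ic v → ∀ h, (th h).1 *ᵥ ic w = ic w →
        (ρ (p1 * q * h)).1 *ᵥ x ∈ E := by
    intro w hw p1 hp1 h1 h2 q hq
    obtain ⟨U1, hU1, H1⟩ := H w hw p1 hp1 h1 h2
    have hdot : ic w ⬝ᵥ ic v = 0 := by rw [← th_dot p1]; exact hE _ h2 _ h1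
    refine lemM (MonoidHom.id _) tau_id ρ hρ E x (p1 * q) hw (ic_ne hv) hdot
      ((fun h => p1 * h) ⁻¹' U1)
      ((continuous_const_mul p1).continuousAt.preimage_mem_nhds (by simpa using hU1)) ?_
    intro h hh hhU z c hz hc e
    simp only [MonoidHom.id_apply] at hh e
    have hp2 : (p1 * h).1 *ᵥ ic z ∈ E1 := by
      rw [mul_act, e, Matrix.mulVec_smul]; exact E1.smul_mem _ h1
    obtain ⟨U2, hU2, H2⟩ := H1 z hz (p1 * h) hhU (by rw [map_mul, mul_act, hh]; exact h2) hp2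
    have := cont_ext' (St (MonoidHom.id _) (ic z)) (NG_St _ continuous_id (fun _ => rfl) _) ρ E x
      (p1 * h) ⟨(fun s => p1 * h * s) ⁻¹' U2,
        (continuous_const_mul _).continuousAt.preimage_mem_nhds (by simpa using hU2), fun s hs hsU => by
          apply H2 _ hsU
          have hs' := (mem_St _ _ _).mp hs
          simp only [MonoidHom.id_apply] at hs'
          rw [mul_act, hs']; exact hp2⟩ (h⁻¹ * q * h) ((mem_St _ _ _).mpr (conjfix _ _ _ _ _ hq e))
    convert this using 4
    group
  have step3 : ∀ q1 q2 q3 : SL(n, ℝ), q1.1 *ᵥ ic v = ic v →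
      (th q2).1 *ᵥ ((th p)⁻¹.1 *ᵥ e2) = ((th p)⁻¹.1 *ᵥ e2) → q3.1 *ᵥ ic v = ic v →
      (ρ (p * q1 * q2 * q3)).1 *ᵥ x ∈ E := by
    intro q1 q2 q3 hq1 hq2 hq3
    have hdot : ic v ⬝ᵥ ((th p)⁻¹.1 *ᵥ e2) = 0 := by
      rw [dotProduct_comm, ← th_dot p, act_inv]; exact hE _ he2 _ hpv
    refine lemM th tau_th ρ hρ E x (p * q1 * q2) hv (act_ne _ he20) hdot ((fun h => p * h) ⁻¹' U)
      ((continuous_const_mul p).continuousAt.preimage_mem_nhds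
        (by simpa using hU.mem_nhds hpU)) ?_ q3 (by rwa [th_th])
    intro h hh hhU z c hz hc e
    rw [th_th] at hh
    have := step2 z hz (p * h) hhU (by rw [mul_act, hh]; exact hpv)
      (by rw [map_mul, mul_act, e, Matrix.mulVec_smul, act_inv]; exact E2.smul_mem _ he2)
      (h⁻¹ * q1 * h) (conjfix _ _ _ _ 1 hq1 (by rw [hh, one_smul])) (h⁻¹ * q2 * h)
      (by rw [map_mul, map_mul, map_inv]; exact conjfix _ _ _ _ _ hq2 e)
    convert this using 4
    group
  obtain ⟨g, hg⟩ := hZ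
  obtain ⟨q1, q2, q3, e, f1, f2, f3⟩ := decomp hn (ic_ne hv) (act_ne (th p)⁻¹ he20)
    (by rw [← th_dot p, act_inv]; exact hE _ he2 _ hpv) (p⁻¹ * g)
  apply hg
  have := step3 q1 q2 q3 f1 f2 f3
  rwa [show p * q1 * q2 * q3 = p * (q1 * q2 * q3) by group, ← e, mul_inv_cancel_left] at this

end Dani

namespace Dani

/-- contracted vectors -/
def con {l : ℕ} (b : ℝ → SL(l, ℝ)) : Submodule ℝ (Fin l → ℝ) where
  carrier := {y | Tendsto (fun t => (b t).1 *ᵥ y) atTop (𝓝 0)}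
  zero_mem' := by simp [Matrix.mulVec_zero]
  add_mem' := by
    intro y z hy hz
    have := Tendsto.add hy hz
    simpa [Matrix.mulVec_add] using this
  smul_mem' := by
    intro c y hy
    have := Tendsto.const_smul hy c
    simpa [Matrix.mulVec_smul] using this

theorem mem_con {l : ℕ} (b : ℝ → SL(l, ℝ)) (y : Fin l → ℝ) :
    y ∈ con b ↔ Tendsto (fun t => (b t).1 *ᵥ y) atTop (𝓝 0) := Iff.rfl

theorem con_dot {n : ℕ} (b : ℝ → SL(n, ℝ)) : ∀ y ∈ con (fun t => th (b t)), ∀ z ∈ con b,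
    y ⬝ᵥ z = 0 := by
  intro y hy z hz
  rw [mem_con] at hy hz
  have hc : Continuous fun p : (Fin n → ℝ) × (Fin n → ℝ) => p.1 ⬝ᵥ p.2 := by
    unfold dotProduct; fun_prop
  have h := (hc.tendsto (0, 0)).comp (hy.prodMk_nhds hz)
  simp only [Function.comp_def, th_dot, dotProduct_zero] at h
  exact tendsto_nhds_unique tendsto_const_nhds h

theorem con_unif {n : ℕ} (b : ℝ → SL(n, ℝ)) (R ε : ℝ) (hε : 0 < ε) :
    ∃ T : ℝ, ∀ t ≥ T, ∀ y ∈ con b, ‖y‖ ≤ R → ‖(b t).1 *ᵥ y‖ < ε := by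
  let B := Module.finBasis ℝ (con b)
  let e := B.equivFunL
  have hsum : Tendsto (fun t => (‖(e : con b →L[ℝ] (Fin (Module.finrank ℝ (con b)) → ℝ))‖ * R) * ∑ i, ‖(b t).1 *ᵥ (B i).1‖) atTop (𝓝 0) := by
    have : Tendsto (fun t => ∑ i, ‖(b t).1 *ᵥ (B i).1‖) atTop (𝓝 0) := by
      have := tendsto_finsetSum (Finset.univ) fun i _ => ((mem_con b _).mp (B i).2).norm
      simpa using this
    simpa using this.const_mul _
  obtain ⟨T, hT⟩ := eventually_atTop.mp (hsum.eventually (gt_mem_nhds hε))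
  refine ⟨T, fun t ht y hy hyR => lt_of_le_of_lt ?_ (hT t ht)⟩
  have h1 : y = ∑ i, (e ⟨y, hy⟩ i) • (B i).1 := by
    have := congrArg Subtype.val (B.sum_equivFun ⟨y, hy⟩)
    rw [Submodule.coe_sum] at this
    exact this.symm
  conv_lhs => rw [h1]
  rw [Matrix.mulVec_sum, Finset.mul_sum]
  refine (norm_sum_le _ _).trans (Finset.sum_le_sum fun i _ => ?_)
  rw [Matrix.mulVec_smul, norm_smul]
  refine mul_le_mul_of_nonneg_right ?_ (norm_nonneg _)
  refine (norm_le_pi_norm (e ⟨y, hy⟩) i).trans ?_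
  refine ((e : con b →L[ℝ] (Fin (Module.finrank ℝ (con b)) → ℝ)).le_opNorm ⟨y, hy⟩).trans ?_
  exact mul_le_mul_of_nonneg_left hyR (norm_nonneg _)

theorem one_param {n : ℕ} (b : ℝ → SL(n, ℝ)) (hb : ∀ s t : ℝ, b (s + t) = b s * b t) :
    b 0 = 1 ∧ ∀ t, b (-t) = (b t)⁻¹ := by
  have h0 : b 0 = 1 := by
    have := hb 0 0
    rw [add_zero] at this
    exact left_eq_mul.mp this
  refine ⟨h0, fun t => ?_⟩
  apply eq_inv_of_mul_eq_one_left
  rw [← hb, neg_add_cancel, h0]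

theorem exists_contr {n : ℕ} (b : ℝ → SL(n, ℝ)) (hb : ∀ s t : ℝ, b (s + t) = b s * b t)
    (hc : Continuous b) (hnt : ∃ t, b t ≠ 1)
    (hd : ∀ t, ∃ (P Q : Matrix (Fin n) (Fin n) ℝ) (d : Fin n → ℝ), P * Q = 1 ∧ Q * P = 1 ∧
      (b t).1 = P * Matrix.diagonal d * Q) : con b ≠ ⊥ := by
  obtain ⟨h0, hneg⟩ := one_param b hb
  obtain ⟨s, hs, hbs⟩ : ∃ s > 0, b (s + s) ≠ 1 := by
    obtain ⟨t, ht⟩ := hnt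
    rcases lt_trichotomy t 0 with h | h | h
    · refine ⟨-t / 2, by linarith, ?_⟩
      rw [add_halves, hneg]
      simpa using ht
    · exact absurd h0 (h ▸ ht)
    · exact ⟨t / 2, by linarith, by rwa [add_halves]⟩
  obtain ⟨P, Q, d, hPQ, hQP, he⟩ := hd s
  have hdet : ∏ i, d i = 1 := by
    have h1 := (b s).2
    have h2 : P.det * Q.det = 1 := by rw [← Matrix.det_mul, hPQ, Matrix.det_one]
    rw [he, Matrix.det_mul, Matrix.det_mul, Matrix.det_diagonal] at h1
    calc ∏ i, d i = (P.det * Q.det) * ∏ i, d i := by rw [h2, one_mul]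
      _ = P.det * (∏ i, d i) * Q.det := by ring
      _ = 1 := h1
  have hlt : ∃ i, |d i| < 1 := by
    by_contra! H
    have hall : ∀ i, |d i| = 1 := by
      intro i
      by_contra hne
      have hlt := Finset.prod_lt_prod (s := Finset.univ) (f := fun _ : Fin n => (1 : ℝ))
        (g := fun i => |d i|) (fun _ _ => one_pos) (fun i _ => H i)
        ⟨i, Finset.mem_univ _, lt_of_le_of_ne (H i) (Ne.symm hne)⟩
      rw [← Finset.abs_prod, hdet] at hlt
      simp at hlt
    apply hbs
    rw [hb]
    apply Subtype.ext
    show (b s).1 * (b s).1 = 1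
    rw [he]
    have h1 : Matrix.diagonal d * Matrix.diagonal d = 1 := by
      rw [Matrix.diagonal_mul_diagonal, ← Matrix.diagonal_one]
      congr 1
      funext i
      rw [← abs_mul_abs_self, hall]; norm_num
    calc P * diagonal d * Q * (P * diagonal d * Q)
        = P * (diagonal d * (Q * P) * diagonal d) * Q := by simp only [Matrix.mul_assoc]
      _ = 1 := by rw [hQP, Matrix.mul_one, h1, Matrix.mul_one, hPQ]
  obtain ⟨i, hi⟩ := hlt
  set y := P *ᵥ Pi.single i 1 with hy
  have hy0 : y ≠ 0 := by
    intro h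
    have : Q *ᵥ y = Pi.single i 1 := by rw [hy, Matrix.mulVec_mulVec, hQP, Matrix.one_mulVec]
    rw [h, Matrix.mulVec_zero] at this
    have := congrFun this i
    simp at this
  have hby : (b s).1 *ᵥ y = d i • y := by
    rw [he, hy, Matrix.mulVec_mulVec, Matrix.mul_assoc, hQP, Matrix.mul_one, ← Matrix.mulVec_mulVec]
    rw [← Matrix.mulVec_smul]
    congr 1
    funext j
    rw [Matrix.mulVec_diagonal]
    by_cases h : j = i
    · subst h; simp
    · simp [h]
  have hbm : ∀ m : ℕ, (b (m * s)).1 *ᵥ y = d i ^ m • y := by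
    intro m
    induction m with
    | zero => simp [h0]
    | succ m ih =>
      rw [show ((m + 1 : ℕ) : ℝ) * s = s + m * s by push_cast; ring, hb, mul_act, ih,
        Matrix.mulVec_smul, hby, smul_smul, pow_succ]
  have hcy : Continuous fun t => (b t).1 *ᵥ y := (cont_mulVec y).comp hc
  obtain ⟨C, hC⟩ := (isCompact_Icc (a := (0 : ℝ)) (b := s)).exists_bound_of_continuousOn hcy.continuousOn
  have hmem : y ∈ con b := by
    rw [mem_con]
    have hfl : Tendsto (fun t : ℝ => |d i| ^ ⌊t / s⌋₊ * C) atTop (𝓝 0) := by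
      have h1 : Tendsto (fun t : ℝ => ⌊t / s⌋₊) atTop atTop :=
        tendsto_nat_floor_atTop.comp (tendsto_id.atTop_div_const hs)
      have := ((tendsto_pow_atTop_nhds_zero_of_lt_one (abs_nonneg _) hi).comp h1).mul_const C
      simpa using this
    refine squeeze_zero_norm' ?_ hfl
    filter_upwards [eventually_ge_atTop 0] with t ht
    have hts : 0 ≤ t / s := div_nonneg ht hs.le
    have hfl := Nat.floor_le hts
    have hfl2 := Nat.lt_floor_add_one (t / s)
    rw [le_div_iff₀ hs] at hfl
    rw [div_lt_iff₀ hs] at hfl2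
    have e : t = (t - ⌊t / s⌋₊ * s) + ⌊t / s⌋₊ * s := by ring
    have hb2 : (b t).1 *ᵥ y = d i ^ ⌊t / s⌋₊ • ((b (t - ⌊t / s⌋₊ * s)).1 *ᵥ y) := by
      rw [← Matrix.mulVec_smul, ← hbm, ← mul_act, ← hb, ← e]
    rw [hb2, norm_smul, norm_pow, Real.norm_eq_abs]
    refine mul_le_mul_of_nonneg_left (hC _ ⟨by linarith, by linarith⟩) (by positivity)
  intro hbot
  rw [hbot] at hmem
  exact hy0 ((Submodule.mem_bot ℝ).mp hmem)

theorem G_gen {n : ℕ} (H : Subgroup SL(n, ℝ)) (h : ∀ u φ hh, tv u φ hh ∈ H) (g : SL(n, ℝ)) :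
    g ∈ H := by
  have h1 : g ∈ Fx (⊥ : Submodule ℝ (Fin n → ℝ)) := by
    intro f hf
    rw [(Submodule.mem_bot ℝ).mp hf, Matrix.mulVec_zero]
  have h2 := fix_eq _ h1
  refine (Subgroup.closure_le H).mpr ?_ h2
  rintro _ ⟨u, φ, hh, rfl, -⟩
  exact h u φ hh

/-- a transvection is conjugate to its square -/
theorem tv_sq {n : ℕ} (hn : 3 ≤ n) (u φ : Fin n → ℝ) (h : φ ⬝ᵥ u = 0) :
    ∃ k : SL(n, ℝ), k * tv u φ h * k⁻¹ = tv u φ h * tv u φ h := by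
  by_cases hu : u = 0
  · subst hu
    exact ⟨1, by rw [tv_zero]; simp⟩
  have hu2 : (2 : ℝ) • u ≠ 0 := smul_ne_zero two_ne_zero hu
  obtain ⟨k, h1, h2⟩ := trans0 hn hu hu2 h (by rw [dotProduct_smul, h, smul_zero])
  refine ⟨k, ?_⟩
  rw [tv_conj, tv_mul]
  apply SL_ext; intro x
  rw [tv_act, tv_act, h1, h2, two_smul]

theorem notall {n l : ℕ} (hn : 3 ≤ n) (ρ : SL(n, ℝ) →* SL(l, ℝ)) (a : ℝ → SL(n, ℝ))
    (x : Fin l → ℝ) (hx : x ≠ 0) : ∃ g, (ρ g).1 *ᵥ x ∉ con (fun t => ρ (a t)) := by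
  by_contra! H
  let W : Submodule ℝ (Fin l → ℝ) := Submodule.span ℝ (Set.range fun g => (ρ g).1 *ᵥ x)
  have hWE : W ≤ con (fun t => ρ (a t)) := by
    rw [Submodule.span_le]; rintro _ ⟨g, rfl⟩; exact H g
  have hxW : x ∈ W := Submodule.subset_span ⟨1, by simp⟩
  have hinv : ∀ g, ∀ y ∈ W, Matrix.mulVecLin (ρ g).1 y ∈ W := by
    intro g y hy
    have : W ≤ W.comap (Matrix.mulVecLin (ρ g).1) := by
      rw [Submodule.span_le]; rintro _ ⟨k, rfl⟩
      refine Submodule.subset_span ⟨g * k, ?_⟩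
      simp only [map_mul, mul_act]; rfl
    exact this hy
  let r : SL(n, ℝ) → (W →ₗ[ℝ] W) := fun g => (Matrix.mulVecLin (ρ g).1).restrict (hinv g)
  have hr : ∀ g (y : W), ((r g y : W) : Fin l → ℝ) = (ρ g).1 *ᵥ y.1 := fun g y => rfl
  let D : SL(n, ℝ) →* ℝ :=
    { toFun := fun g => LinearMap.det (r g)
      map_one' := by
        have : r 1 = LinearMap.id := by
          ext1 y; apply Subtype.ext; rw [hr, map_one, one_act]; rfl
        show LinearMap.det (r 1) = 1
        rw [this, LinearMap.det_id]
      map_mul' := by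
        intro g h
        have : r (g * h) = r g ∘ₗ r h := by
          ext1 y; apply Subtype.ext; rw [hr, map_mul, mul_act]; rfl
        show LinearMap.det (r (g * h)) = _
        rw [this, LinearMap.det_comp] }
  have hD : ∀ g, D g = 1 := by
    intro g
    refine G_gen D.ker ?_ g
    intro u φ hh
    obtain ⟨k, hk⟩ := tv_sq hn u φ hh
    have e := congrArg D hk
    have h1 : D k * D k⁻¹ = 1 := by rw [← map_mul, mul_inv_cancel, map_one]
    have h2 : D (tv u φ hh) * D (tv u φ hh)⁻¹ = 1 := by rw [← map_mul, mul_inv_cancel, map_one]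
    rw [map_mul, map_mul, map_mul] at e
    rw [MonoidHom.mem_ker]
    have h3 : D (tv u φ hh) ≠ 0 := left_ne_zero_of_mul_eq_one h2
    apply mul_left_cancel₀ h3
    rw [← e, mul_one]
    linear_combination D (tv u φ hh) * h1
  let B := Module.finBasis ℝ W
  have hlim : Tendsto (fun t => (LinearMap.toMatrix B B (r (a t))).det) atTop
      (𝓝 (0 : Matrix (Fin (Module.finrank ℝ W)) (Fin (Module.finrank ℝ W)) ℝ).det) := by
    have hcd : Continuous fun M : Matrix (Fin (Module.finrank ℝ W)) (Fin (Module.finrank ℝ W)) ℝ =>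
      M.det := continuous_id.matrix_det
    refine (hcd.tendsto 0).comp ?_
    refine tendsto_pi_nhds.mpr fun i => tendsto_pi_nhds.mpr fun j => ?_
    have h1 : Tendsto (fun t => r (a t) (B j)) atTop (𝓝 0) := by
      rw [tendsto_subtype_rng]
      exact hWE (B j).2
    have h2 : Continuous (B.equivFunL) := B.equivFunL.continuous
    have h3 := (tendsto_pi_nhds.mp ((h2.tendsto 0).comp h1)) i
    simpa [LinearMap.toMatrix_apply, Function.comp_def] using h3
  have hne : Nonempty (Fin (Module.finrank ℝ W)) := by
    apply Fin.pos_iff_nonempty.mp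
    rw [Module.finrank_pos_iff]
    exact ⟨⟨⟨x, hxW⟩, 0, fun h => hx (congrArg Subtype.val h)⟩⟩
  rw [Matrix.det_zero] at hlim
  have : ∀ t, (LinearMap.toMatrix B B (r (a t))).det = 1 := by
    intro t
    rw [LinearMap.det_toMatrix]; exact hD (a t)
  simp only [this] at hlim
  exact one_ne_zero (tendsto_nhds_unique tendsto_const_nhds hlim)

end Dani

namespace Dani

theorem uni_poly {l : ℕ} (A : Matrix (Fin l) (Fin l) ℝ) (hA : (A - 1) ^ l = 0) (i j : Fin l) :
    ∃ p : Polynomial ℝ, ∀ k : ℕ, p.eval (k : ℝ) = (A ^ k) i j := by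
  refine ⟨∑ m ∈ Finset.range l, Polynomial.C (((A - 1) ^ m) i j / (m.factorial : ℝ)) * descPochhammer ℝ m,
    fun k => ?_⟩
  have h1 : A ^ k = ∑ m ∈ Finset.range (k + 1), (k.choose m : ℝ) • (A - 1) ^ m := by
    conv_lhs => rw [← sub_add_cancel A 1]
    rw [(Commute.one_right (A - 1)).add_pow]
    refine Finset.sum_congr rfl fun m _ => ?_
    rw [one_pow, mul_one, ← nsmul_eq_mul', Nat.cast_smul_eq_nsmul]
  have h2 : ∀ M, k + 1 ≤ M → ∑ m ∈ Finset.range (k + 1), (k.choose m : ℝ) • (A - 1) ^ m =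
      ∑ m ∈ Finset.range M, (k.choose m : ℝ) • (A - 1) ^ m := by
    intro M hM
    refine Finset.sum_subset (Finset.range_mono hM) fun m _ hm => ?_
    rw [Nat.choose_eq_zero_of_lt (by simpa using hm)]; simp
  have h3 : ∀ M, l ≤ M → ∑ m ∈ Finset.range l, (k.choose m : ℝ) • (A - 1) ^ m =
      ∑ m ∈ Finset.range M, (k.choose m : ℝ) • (A - 1) ^ m := by
    intro M hM
    refine Finset.sum_subset (Finset.range_mono hM) fun m _ hm => ?_
    rw [pow_eq_zero_of_le (by simpa using hm) hA]; simp
  rw [h1, h2 (k + 1 + l) (by omega), ← h3 (k + 1 + l) (by omega), Polynomial.eval_finsetSum,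
    Matrix.sum_apply]
  refine Finset.sum_congr rfl fun m _ => ?_
  rw [Polynomial.eval_mul, Polynomial.eval_C, descPochhammer_eval_eq_descFactorial,
    Nat.descFactorial_eq_factorial_mul_choose, Matrix.smul_apply, smul_eq_mul]
  push_cast
  have : (m.factorial : ℝ) ≠ 0 := by positivity
  field_simp

theorem uni_root {l : ℕ} (A B : Matrix (Fin l) (Fin l) ℝ) (hA : (A - 1) ^ l = 0)
    (hB : (B - 1) ^ l = 0) (m : ℕ) (hm : 0 < m) (h : A ^ m = B ^ m) : A = B := by
  ext i j
  obtain ⟨p, hp⟩ := uni_poly A hA i j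
  obtain ⟨q, hq⟩ := uni_poly B hB i j
  have hpq : p = q := by
    apply Polynomial.eq_of_infinite_eval_eq
    refine Set.infinite_of_injective_forall_mem (f := fun k : ℕ => ((m * k : ℕ) : ℝ)) ?_ ?_
    · intro x y hxy
      have := Nat.cast_injective hxy
      exact Nat.eq_of_mul_eq_mul_left hm this
    · intro k
      show p.eval _ = q.eval _
      rw [hp, hq, pow_mul, pow_mul, h]
  have := hp 1
  rw [hpq, hq 1, pow_one, pow_one] at this
  exact this.symm

theorem rho_uni {n l : ℕ} (hn : 3 ≤ n) (ρ : SL(n, ℝ) →* SL(l, ℝ)) (hρ : Continuous ρ)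
    (u φ : Fin n → ℝ) (h : φ ⬝ᵥ u = 0) : ((ρ (tv u φ h)).1 - 1) ^ l = 0 := by
  have hs : ∀ s : ℝ, φ ⬝ᵥ (s • u) = 0 := fun s => by rw [dotProduct_smul, h, smul_zero]
  have hdet : ∀ x : ℝ, ∀ k : ℕ, (Matrix.scalar (Fin l) x - (ρ (tv (((2 : ℝ)⁻¹ ^ k) • u) φ (hs _))).1).det =
      (Matrix.scalar (Fin l) x - (ρ (tv u φ h)).1).det := by
    intro x k
    induction k with
    | zero => congr 4; simp
    | succ k ih =>
      rw [← ih]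
      obtain ⟨g, hg⟩ := tv_sq hn (((2 : ℝ)⁻¹ ^ (k + 1)) • u) φ (hs _)
      rw [tv_mul] at hg
      have e : tv (((2 : ℝ)⁻¹ ^ (k + 1)) • u + ((2 : ℝ)⁻¹ ^ (k + 1)) • u) φ
          (by rw [dotProduct_add, hs, add_zero]) = tv (((2 : ℝ)⁻¹ ^ k) • u) φ (hs _) := by
        apply SL_ext; intro y
        rw [tv_act, tv_act, ← add_smul]
        congr 3
        rw [pow_succ]; ring
      rw [e] at hg
      rw [← hg, map_mul, map_mul]
      generalize ρ (tv (((2 : ℝ)⁻¹ ^ (k + 1)) • u) φ (hs _)) = M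
      have e2 : Matrix.scalar (Fin l) x - (ρ g * M * ρ g⁻¹).1 =
          (ρ g).1 * (Matrix.scalar (Fin l) x - M.1) * (ρ g⁻¹).1 := by
        have h1 : (ρ g).1 * (ρ g⁻¹).1 = 1 := by
          have : ρ g * ρ g⁻¹ = 1 := by rw [← map_mul, mul_inv_cancel, map_one]
          exact congrArg Subtype.val this
        rw [Matrix.mul_sub, Matrix.sub_mul]
        have h2 : (ρ g).1 * Matrix.scalar (Fin l) x = Matrix.scalar (Fin l) x * (ρ g).1 :=
          (Matrix.scalar_commute x (fun r => Commute.all _ _) _).symm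
        rw [h2, Matrix.mul_assoc (Matrix.scalar (Fin l) x), h1, Matrix.mul_one]
        rfl
      rw [e2, Matrix.det_mul, Matrix.det_mul, (ρ g).2, (ρ g⁻¹).2, one_mul, mul_one]
  have hdet1 : ∀ x : ℝ, (Matrix.scalar (Fin l) x - (ρ (tv u φ h)).1).det = (x - 1) ^ l := by
    intro x
    have h1 : Tendsto (fun k : ℕ => (2 : ℝ)⁻¹ ^ k) atTop (𝓝 0) :=
      tendsto_pow_atTop_nhds_zero_of_lt_one (by norm_num) (by norm_num)
    have h2 := (hρ.tendsto 1).comp ((tv_tendsto u φ h).comp h1)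
    have hc : Continuous fun M : SL(l, ℝ) => (Matrix.scalar (Fin l) x - M.1).det :=
      (continuous_const.sub cont_val).matrix_det
    have h3 := (hc.tendsto _).comp h2
    simp only [Function.comp_def, hdet x, map_one] at h3
    have h4 := tendsto_nhds_unique tendsto_const_nhds h3
    rw [h4]
    have : Matrix.scalar (Fin l) x - (1 : SL(l, ℝ)).1 = Matrix.diagonal fun _ => x - 1 := by
      ext i j
      by_cases hij : i = j
      · subst hij; simp
      · simp [hij]
    rw [this, Matrix.det_diagonal]; simp
  have hcp : (ρ (tv u φ h)).1.charpoly = (Polynomial.X - Polynomial.C 1) ^ l := by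
    apply Polynomial.funext
    intro x
    rw [Matrix.eval_charpoly, hdet1]; simp
  have := Matrix.aeval_self_charpoly (ρ (tv u φ h)).1
  rw [hcp] at this
  simpa using this

theorem rig1 {n l : ℕ} (hn : 3 ≤ n) (ρ1 ρ2 : SL(n, ℝ) →* SL(l, ℝ)) (h1 : Continuous ρ1)
    (h2 : Continuous ρ2) (u φ : Fin n → ℝ) (h : φ ⬝ᵥ u = 0) (he : ρ1 (tv u φ h) = ρ2 (tv u φ h))
    (s : ℝ) (hs : φ ⬝ᵥ (s • u) = 0) : ρ1 (tv (s • u) φ hs) = ρ2 (tv (s • u) φ hs) := by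
  have hs' : ∀ s : ℝ, φ ⬝ᵥ (s • u) = 0 := fun s => by rw [dotProduct_smul, h, smul_zero]
  have hm : ∀ m : ℕ, 0 < m → ρ1 (tv ((m : ℝ)⁻¹ • u) φ (hs' _)) = ρ2 (tv ((m : ℝ)⁻¹ • u) φ (hs' _)) := by
    intro m hm
    apply Subtype.ext
    refine uni_root _ _ (rho_uni hn ρ1 h1 _ _ _) (rho_uni hn ρ2 h2 _ _ _) m hm ?_
    have e : tv ((m : ℝ)⁻¹ • u) φ (hs' _) ^ m = tv u φ h := by
      rw [tv_pow]
      apply SL_ext; intro x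
      rw [tv_act, tv_act, smul_inv_smul₀ (by positivity)]
    have := he
    rw [← e, map_pow, map_pow] at this
    exact congrArg Subtype.val this
  have hk : ∀ m : ℕ, 0 < m → ∀ k : ℕ, ρ1 (tv ((k : ℝ) • (m : ℝ)⁻¹ • u) φ (by rw [smul_smul]; exact hs' _)) =
      ρ2 (tv ((k : ℝ) • (m : ℝ)⁻¹ • u) φ (by rw [smul_smul]; exact hs' _)) := by
    intro m hm0 k
    rw [← tv_pow _ _ (hs' _), map_pow, map_pow, hm m hm0]
  have hq : ∀ q : ℚ, ρ1 (tv ((q : ℝ) • u) φ (hs' _)) = ρ2 (tv ((q : ℝ) • u) φ (hs' _)) := by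
    intro q
    have hcase : ∀ k : ℤ, ρ1 (tv ((k : ℝ) • (q.den : ℝ)⁻¹ • u) φ (by rw [smul_smul]; exact hs' _)) =
      ρ2 (tv ((k : ℝ) • (q.den : ℝ)⁻¹ • u) φ (by rw [smul_smul]; exact hs' _)) := by
      intro k
      obtain ⟨k, rfl | rfl⟩ := k.eq_nat_or_neg
      · exact hk q.den q.den_pos k
      · have e := congrArg (fun g => g⁻¹) (hk q.den q.den_pos k)
        simp only [← map_inv, tv_inv] at e
        simpa [neg_smul] using e
    have e := hcase q.num
    have e2 : (q : ℝ) • u = (q.num : ℝ) • (q.den : ℝ)⁻¹ • u := by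
      rw [smul_smul, ← div_eq_mul_inv, Rat.cast_def]
    simp only [e2]
    exact e
  have c0 : Continuous fun s : ℝ => tv (s • u) φ (hs' s) :=
    cont_tv (fun s : ℝ => s • u) (fun _ => φ) hs' (by fun_prop) continuous_const
  have := (Rat.denseRange_cast (𝕜 := ℝ)).equalizer (h1.comp c0) (h2.comp c0) (funext hq)
  exact congrFun this s

theorem ss_dot {n : ℕ} (φ : Fin n → ℝ) (i : Fin n) : φ ⬝ᵥ Pi.single i 1 = φ i := by simp

theorem gen_of_elem {n : ℕ} (hn : 3 ≤ n) (H : Subgroup SL(n, ℝ))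
    (h : ∀ i j : Fin n, ∀ s : ℝ, ∀ hh, tv (s • Pi.single i 1) (Pi.single j 1) hh ∈ H) (g : SL(n, ℝ)) :
    g ∈ H := by
  have e1 : ∀ (j : Fin n) (S : Finset (Fin n)) (u : Fin n → ℝ), j ∉ S →
      ∀ hh, tv (∑ i ∈ S, u i • Pi.single i 1) (Pi.single j 1) hh ∈ H := by
    intro j S u
    induction S using Finset.induction_on with
    | empty => intro _ hh; simp only [Finset.sum_empty]; rw [tv_zero]; exact one_mem _
    | insert i S hi ih =>
      intro hj hh
      rw [Finset.mem_insert, not_or] at hj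
      have a1 : (Pi.single j 1 : Fin n → ℝ) ⬝ᵥ (u i • Pi.single i 1) = 0 := by
        simp [Pi.single_apply, hj.1]
      have a2 : (Pi.single j 1 : Fin n → ℝ) ⬝ᵥ (∑ i ∈ S, u i • Pi.single i 1) = 0 := by
        have := hh
        rw [Finset.sum_insert hi, dotProduct_add, a1, zero_add] at this
        exact this
      simp only [Finset.sum_insert hi]
      rw [← tv_mul _ _ _ a1 a2]
      exact mul_mem (h _ _ _ _) (ih hj.2 _)
  have e1' : ∀ (j : Fin n) (u : Fin n → ℝ) hh, tv u (Pi.single j 1) hh ∈ H := by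
    intro j u hh
    have huj : u j = 0 := by simpa using hh
    have : u = ∑ i ∈ Finset.univ.erase j, u i • Pi.single i 1 := by
      conv_lhs => rw [pi_eq_sum_univ' u]
      rw [← Finset.add_sum_erase _ _ (Finset.mem_univ j), huj, zero_smul, zero_add]
    have e := e1 j (Finset.univ.erase j) u (by simp) (by rw [← this]; exact hh)
    simp only [← this] at e
    exact e
  have e2 : ∀ (j : Fin n) (S : Finset (Fin n)) (u : Fin n → ℝ), j ∉ S →
      ∀ hh, tv (Pi.single j 1) (∑ i ∈ S, u i • Pi.single i 1) hh ∈ H := by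
    intro j S u
    induction S using Finset.induction_on with
    | empty => intro _ hh; simp only [Finset.sum_empty]; rw [tv_zero']; exact one_mem _
    | insert i S hi ih =>
      intro hj hh
      rw [Finset.mem_insert, not_or] at hj
      have a1 : (u i • Pi.single i 1 : Fin n → ℝ) ⬝ᵥ (Pi.single j 1) = 0 := by
        simp [Pi.single_apply, hj.1]
      have a2 : (∑ i ∈ S, u i • Pi.single i 1) ⬝ᵥ (Pi.single j 1 : Fin n → ℝ) = 0 := by
        have := hh
        rw [Finset.sum_insert hi, add_dotProduct, a1, zero_add] at this
        exact this
      simp only [Finset.sum_insert hi]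
      rw [← tv_mul' _ _ _ a1 a2]
      refine mul_mem ?_ (ih hj.2 _)
      have a3 : (Pi.single i 1 : Fin n → ℝ) ⬝ᵥ (u i • Pi.single j 1) = 0 := by
        simp [Pi.single_apply, hj.1]
      have := h j i (u i) a3
      convert this using 1
      apply SL_ext; intro x
      rw [tv_act, tv_act, smul_dotProduct, smul_smul, smul_eq_mul, mul_comm]
  have e2' : ∀ (j : Fin n) (u : Fin n → ℝ) hh, tv (Pi.single j 1) u hh ∈ H := by
    intro j u hh
    have huj : u j = 0 := by simpa using hh
    have : u = ∑ i ∈ Finset.univ.erase j, u i • Pi.single i 1 := by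
      conv_lhs => rw [pi_eq_sum_univ' u]
      rw [← Finset.add_sum_erase _ _ (Finset.mem_univ j), huj, zero_smul, zero_add]
    have e := e2 j (Finset.univ.erase j) u (by simp) (by rw [← this]; exact hh)
    simp only [← this] at e
    exact e
  have tr : ∀ v : Fin n → ℝ, v ≠ 0 → ∃ k ∈ H, k.1 *ᵥ v = 1 := by
    intro v hv
    obtain ⟨j, hj⟩ : ∃ j, v j ≠ 0 := by
      by_contra! H; exact hv (funext H)
    obtain ⟨i, hi⟩ : ∃ i : Fin n, i ≠ j := by
      have : Nontrivial (Fin n) := Fin.nontrivial_iff_two_le.mpr (by omega)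
      exact exists_ne j
    have a1 : (Pi.single j 1 : Fin n → ℝ) ⬝ᵥ (((v j)⁻¹ * (1 - v i)) • Pi.single i 1) = 0 := by
      simp [Pi.single_apply, hi]
    set v' := (tv _ _ a1).1 *ᵥ v with hv'
    have hvi : v' i = 1 := by
      rw [hv', tv_act]
      simp
      field_simp; ring
    have a2 : (Pi.single i 1 : Fin n → ℝ) ⬝ᵥ (1 - v') = 0 := by simp [hvi]
    refine ⟨tv _ _ a2 * tv _ _ a1, mul_mem (e1' _ _ _) (e1' _ _ _), ?_⟩
    rw [mul_act, ← hv', tv_act]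
    simp [hvi]
  refine G_gen H ?_ g
  intro u φ hh
  by_cases hu : u = 0
  · subst hu; rw [tv_zero]; exact one_mem _
  have i0 : Fin n := ⟨0, by omega⟩
  obtain ⟨k1, hk1, f1⟩ := tr u hu
  obtain ⟨k2, hk2, f2⟩ := tr (Pi.single i0 1) (by intro h; have := congrFun h i0; simp at this)
  have f3 : (k2⁻¹ * k1).1 *ᵥ u = Pi.single i0 1 := by rw [mul_act, f1, ← f2, inv_act]
  have hk : k2⁻¹ * k1 ∈ H := mul_mem (inv_mem hk2) hk1
  have e := tv_conj (k2⁻¹ * k1) u φ hh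
  have : (k2⁻¹ * k1) * tv u φ hh * (k2⁻¹ * k1)⁻¹ ∈ H := by
    rw [e]; simp only [f3]; exact e2' _ _ _
  have h2 := mul_mem (mul_mem (inv_mem hk) this) hk
  convert h2 using 1
  group

theorem rigid {n l : ℕ} (hn : 3 ≤ n) (ρ1 ρ2 : SL(n, ℝ) →* SL(l, ℝ)) (h1 : Continuous ρ1)
    (h2 : Continuous ρ2)
    (he : ∀ i j : Fin n, ∀ hh, ρ1 (tv (Pi.single i 1) (Pi.single j 1) hh) =
      ρ2 (tv (Pi.single i 1) (Pi.single j 1) hh)) : ρ1 = ρ2 := by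
  apply MonoidHom.ext
  intro g
  refine gen_of_elem hn (ρ1.eqLocus ρ2) ?_ g
  intro i j s hh
  show ρ1 _ = ρ2 _
  by_cases hij : (Pi.single j 1 : Fin n → ℝ) ⬝ᵥ Pi.single i 1 = 0
  · exact rig1 hn ρ1 ρ2 h1 h2 _ _ hij (he i j hij) s hh
  · have hs : s = 0 := by
      rw [dotProduct_smul, smul_eq_mul] at hh
      rcases mul_eq_zero.mp hh with h | h
      · exact h
      · exact absurd h hij
    subst hs
    simp only [zero_smul]
    rw [tv_zero, map_one, map_one]

theorem elem_mem {n : ℕ} (i j : Fin n) (hh : (Pi.single j 1 : Fin n → ℝ) ⬝ᵥ Pi.single i 1 = 0) :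
    tv (Pi.single i 1) (Pi.single j 1) hh ∈ SLZ n := by
  have hij : i ≠ j := by
    rintro rfl; simp at hh
  refine ⟨⟨Matrix.transvection i j 1, Matrix.det_transvection_of_ne i j hij 1⟩, ?_⟩
  apply Subtype.ext
  rw [tv_val]
  ext a b
  show (((Matrix.transvection i j (1 : ℤ)) a b : ℤ) : ℝ) = _
  have h0 : ¬ (i = a ∧ j = b ∧ a = b) := fun h => hij (h.1.trans (h.2.2.trans h.2.1.symm))
  by_cases h1 : i = a <;> by_cases h2 : j = b <;> by_cases h3 : a = b <;>
    simp [Matrix.transvection, Matrix.single_apply, Matrix.one_apply, vecMulVec_apply, Pi.single_apply,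
      h1, h2, h3, eq_comm]
  exact absurd ⟨h1, h2, h3⟩ h0

abbrev Rep (n l : ℕ) := {ρ : SL(n, ℝ) →* SL(l, ℝ) // Continuous ρ ∧ ∀ γ ∈ SLZ n, ρ γ ∈ SLZ l}

theorem rep_countable {n : ℕ} (hn : 3 ≤ n) (l : ℕ) : Countable (Rep n l) := by
  have hA : ∀ (ρ : Rep n l) (i j : Fin n) , ∃ A : Fin l → Fin l → ℤ,
      ∀ hh : (Pi.single j 1 : Fin n → ℝ) ⬝ᵥ Pi.single i 1 = 0, ∀ a b,
      (ρ.1 (tv (Pi.single i 1) (Pi.single j 1) hh)).1 a b = (A a b : ℝ) := by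
    intro ρ i j
    by_cases hh : (Pi.single j 1 : Fin n → ℝ) ⬝ᵥ Pi.single i 1 = 0
    · obtain ⟨B, hB⟩ := ρ.2.2 _ (elem_mem i j hh)
      refine ⟨B.1, fun _ a b => ?_⟩
      rw [← hB]; rfl
    · exact ⟨0, fun h => absurd h hh⟩
  choose A hA using hA
  apply Function.Injective.countable (f := A)
  intro ρ1 ρ2 h
  apply Subtype.ext
  apply rigid hn _ _ ρ1.2.1 ρ2.2.1
  intro i j hh
  apply Subtype.ext
  ext a b
  rw [hA ρ1 i j hh a b, hA ρ2 i j hh a b, h]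

end Dani

namespace Dani

def Short {n : ℕ} (ε : ℝ) (k : SL(n, ℝ)) : Prop :=
  ∃ v : Fin n → ℤ, v ≠ 0 ∧ (‖k.1 *ᵥ ic v‖ < ε ∨ ‖(th k).1 *ᵥ ic v‖ < ε)

theorem ic_norm {n : ℕ} {v : Fin n → ℤ} (hv : v ≠ 0) : 1 ≤ ‖ic v‖ := by
  obtain ⟨i, hi⟩ : ∃ i, v i ≠ 0 := by
    by_contra! H; exact hv (funext H)
  refine le_trans ?_ (norm_le_pi_norm (ic v) i)
  rw [ic, Real.norm_eq_abs]
  exact_mod_cast Int.one_le_abs hi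

theorem mulVec_bound {n : ℕ} (M : Matrix (Fin n) (Fin n) ℝ) (m : ℝ) (hm : ∀ i j, |M i j| ≤ m)
    (hm0 : 0 ≤ m) (y : Fin n → ℝ) : ‖M *ᵥ y‖ ≤ n * m * ‖y‖ := by
  rw [pi_norm_le_iff_of_nonneg (by positivity)]
  intro i
  rw [Matrix.mulVec, dotProduct]
  refine (norm_sum_le _ _).trans ?_
  calc ∑ j, ‖M i j * y j‖ ≤ ∑ _j : Fin n, m * ‖y‖ := by
        refine Finset.sum_le_sum fun j _ => ?_
        rw [norm_mul]
        exact mul_le_mul (hm i j) (norm_le_pi_norm y j) (norm_nonneg _) hm0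
    _ = n * m * ‖y‖ := by simp [mul_assoc]

theorem SLZ_act {n : ℕ} (γ : SL(n, ℝ)) (hγ : γ ∈ SLZ n) (v : Fin n → ℤ) (hv : v ≠ 0) :
    ∃ u : Fin n → ℤ, u ≠ 0 ∧ γ.1 *ᵥ ic v = ic u := by
  obtain ⟨A, rfl⟩ := hγ
  have h : ((Matrix.SpecialLinearGroup.map (Int.castRingHom ℝ)) A).1 *ᵥ ic v = ic (A.1 *ᵥ v) := by
    funext i
    simp only [Matrix.mulVec, dotProduct, ic]
    push_cast
    rfl
  refine ⟨A.1 *ᵥ v, ?_, h⟩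
  intro h0
  rw [h0] at h
  exact act_ne _ (ic_ne hv) (h.trans (by funext i; simp [ic]))

theorem SLZ_th {n : ℕ} (γ : SL(n, ℝ)) (hγ : γ ∈ SLZ n) : th γ ∈ SLZ n := by
  obtain ⟨A, h⟩ := inv_mem hγ
  refine ⟨A.transpose, ?_⟩
  apply Subtype.ext
  rw [th_val, ← h]
  rfl

theorem diverge {n : ℕ} (f : ℝ → SL(n, ℝ)) (h : ∀ ε > 0, ∀ᶠ t in atTop, Short ε (f t)) :
    Tendsto (fun t : ℝ => ((f t : SL(n, ℝ)) : SL(n, ℝ) ⧸ SLZ n)) atTop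
      (cocompact (SL(n, ℝ) ⧸ SLZ n)) := by
  rw [hasBasis_cocompact.tendsto_right_iff]
  intro K hK
  let O : ℕ → Set SL(n, ℝ) := fun m => {g | ∀ i j, |g.1 i j| < m ∧ |(th g).1 i j| < m}
  have hO : ∀ m, IsOpen (O m) := by
    intro m
    simp only [O, Set.ofPred_forall]
    refine isOpen_iInter_of_finite fun i => isOpen_iInter_of_finite fun j => ?_
    refine IsOpen.and ?_ ?_
    · exact isOpen_lt (cont_val.matrix_elem i j).abs continuous_const
    · exact isOpen_lt ((cont_val.comp cont_th).matrix_elem i j).abs continuous_const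
  have hcov : K ⊆ ⋃ m, (QuotientGroup.mk : SL(n, ℝ) → SL(n, ℝ) ⧸ SLZ n) '' O m := by
    intro q _
    obtain ⟨g, rfl⟩ := QuotientGroup.mk_surjective q
    obtain ⟨m, hm⟩ := exists_nat_gt (∑ i, ∑ j, (|g.1 i j| + |(th g).1 i j|))
    refine Set.mem_iUnion.mpr ⟨m, g, fun i j => ?_, rfl⟩
    have h1 : |g.1 i j| + |(th g).1 i j| ≤ ∑ i, ∑ j, (|g.1 i j| + |(th g).1 i j|) := by
      refine le_trans ?_ (Finset.single_le_sum (f := fun i => ∑ j, (|g.1 i j| + |(th g).1 i j|))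
        (fun i _ => Finset.sum_nonneg fun j _ => by positivity) (Finset.mem_univ i))
      exact Finset.single_le_sum (f := fun j => (|g.1 i j| + |(th g).1 i j|))
        (fun j _ => by positivity) (Finset.mem_univ j)
    have h2 := abs_nonneg (g.1 i j)
    have h3 := abs_nonneg ((th g).1 i j)
    constructor <;> linarith
  obtain ⟨m, hm⟩ := hK.elim_directed_cover _ (fun m => QuotientGroup.isOpenMap_coe _ (hO m)) hcov (by
    apply Monotone.directed_le
    intro a b hab
    refine Set.image_mono fun g hg i j => ?_
    have : (a : ℝ) ≤ b := by exact_mod_cast hab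
    exact ⟨(hg i j).1.trans_le this, (hg i j).2.trans_le this⟩)
  have hpos : (0 : ℝ) < (n * m + 1 : ℝ)⁻¹ := by positivity
  filter_upwards [h _ hpos] with t ht hK'
  obtain ⟨k, hk, hkt⟩ := hm hK'
  have hγ : k⁻¹ * f t ∈ SLZ n := QuotientGroup.eq.mp hkt
  have hf : f t = k * (k⁻¹ * f t) := by group
  obtain ⟨v, hv, hs⟩ := ht
  have fin : ∀ y : Fin n → ℝ, ‖y‖ < (n * m + 1 : ℝ)⁻¹ → n * m * ‖y‖ < 1 := by
    intro y hy
    have h1 : ‖y‖ * (n * m + 1 : ℝ) < 1 := by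
      rwa [← lt_div_iff₀ (by positivity), one_div]
    nlinarith [norm_nonneg y]
  rcases hs with hs | hs
  · obtain ⟨u, hu, hu2⟩ := SLZ_act _ hγ v hv
    rw [hf, mul_act, hu2] at hs
    have h1 := mulVec_bound (k⁻¹).1 m (fun i j => by
      have := (hk j i).2.le
      rwa [th_val, Matrix.transpose_apply] at this) (by positivity) (k.1 *ᵥ ic u)
    rw [inv_act] at h1
    linarith [ic_norm hu, fin _ hs]
  · obtain ⟨u, hu, hu2⟩ := SLZ_act _ (SLZ_th _ hγ) v hv
    rw [hf, map_mul, mul_act, hu2] at hs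
    have h1 := mulVec_bound ((th k)⁻¹).1 m (fun i j => by
      have := (hk j i).1.le
      rw [← th_th k, th_val, Matrix.transpose_apply] at this
      exact this) (by positivity) ((th k).1 *ᵥ ic u)
    rw [inv_act] at h1
    linarith [ic_norm hu, fin _ hs]

theorem tube {X : Type*} [TopologicalSpace X] (K : Set ℝ) (hK : IsCompact K) (f : X → ℝ → ℝ)
    (hf : Continuous fun q : X × ℝ => f q.1 q.2) (ε : ℝ) (p : X) (h : ∀ t ∈ K, f p t < ε) :
    ∃ O : Set X, IsOpen O ∧ p ∈ O ∧ ∀ g ∈ O, ∀ t ∈ K, f g t < ε := by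
  have := hK.eventually_forall_of_forall_eventually (x₀ := p) (P := fun g t => f g t < ε) (by
    intro t ht
    exact (isOpen_lt hf continuous_const).mem_nhds (h t ht))
  obtain ⟨O, h1, h2, h3⟩ := eventually_nhds_iff.mp this
  exact ⟨O, h2, h3, h1⟩

def Good {n : ℕ} (a : ℝ → SL(n, ℝ)) (ε : ℝ) (v : Fin n → ℤ) (C : Set SL(n, ℝ)) (T : ℝ) : Prop :=
  v ≠ 0 ∧ IsCompact C ∧ (∃ p ∈ interior C, p.1 *ᵥ ic v ∈ con a) ∧
    ∀ g ∈ C, g.1 *ᵥ ic v ∈ con a → ∀ t ≥ T, ‖(a t * g).1 *ᵥ ic v‖ < ε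

theorem step {n l : ℕ} (hn : 3 ≤ n) (a : ℝ → SL(n, ℝ)) (ha : Continuous a)
    (hE2 : con (fun t => th (a t)) ≠ ⊥) (ρ : SL(n, ℝ) →* SL(l, ℝ)) (hρ : Continuous ρ)
    (x : Fin l → ℝ) (hx : x ≠ 0) (ε ε' : ℝ) (hε : 0 < ε) (hε' : 0 < ε') (v : Fin n → ℤ)
    (C : Set SL(n, ℝ)) (T : ℝ) (hG : Good a ε v C T) :
    ∃ v' C' T', Good a ε' v' C' T' ∧ C' ⊆ C ∧ T + 1 ≤ T' ∧
      (∀ g ∈ C', ∀ t, T ≤ t → t ≤ T' → Short ε (a t * g)) ∧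
      ∀ g ∈ C', (ρ g).1 *ᵥ x ∉ con (fun t => ρ (a t)) := by
  obtain ⟨hv, hC, ⟨p, hp, hpv⟩, hcon⟩ := hG
  obtain ⟨w, hw, p1, hp1, hp1v, hp1w, H⟩ := chain hn (con a) (con fun t => th (a t)) (con_dot a) hE2 ρ hρ
    (con fun t => ρ (a t)) x (notall hn ρ a x hx) hv (interior C) isOpen_interior p hp hpv
  have cf : ∀ u : Fin n → ℤ, Continuous fun q : SL(n, ℝ) × ℝ => ‖(a q.2 * q.1).1 *ᵥ ic u‖ := fun u =>
    ((cont_mulVec (ic u)).comp ((ha.comp continuous_snd).mul continuous_fst)).norm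
  have cf' : ∀ u : Fin n → ℤ, Continuous fun q : SL(n, ℝ) × ℝ => ‖(th (a q.2 * q.1)).1 *ᵥ ic u‖ := fun u =>
    ((cont_mulVec (ic u)).comp (cont_th.comp ((ha.comp continuous_snd).mul continuous_fst))).norm
  obtain ⟨T1, hT1⟩ := con_unif (fun t => th (a t)) (‖(th p1).1 *ᵥ ic w‖ + 1) ε hε
  obtain ⟨O1, hO1, hpO1, hO1'⟩ := tube (Set.Icc T (max T T1)) isCompact_Icc
    (fun g t => ‖(a t * g).1 *ᵥ ic v‖) (cf v) ε p1
    (fun t ht => hcon p1 (interior_subset hp1) hp1v t ht.1)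
  have oN1 : IsOpen {g : SL(n, ℝ) | ‖(th g).1 *ᵥ ic w‖ < ‖(th p1).1 *ᵥ ic w‖ + 1} :=
    isOpen_lt ((cont_mulVec (ic w)).comp cont_th).norm continuous_const
  have oU1 : IsOpen (interior C ∩ O1 ∩ {g : SL(n, ℝ) | ‖(th g).1 *ᵥ ic w‖ < ‖(th p1).1 *ᵥ ic w‖ + 1}) :=
    (isOpen_interior.inter hO1).inter oN1
  obtain ⟨v', hv', p2, hp2, hp2w, hp2v, H2⟩ := H _ (oU1.mem_nhds ⟨⟨hp1, hpO1⟩, by simp⟩)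
  obtain ⟨T2, hT2⟩ := con_unif a (‖p2.1 *ᵥ ic v'‖ + 1) ε' hε'
  set T' := max (T + 1) (max T1 T2) with hT'
  obtain ⟨O2, hO2, hpO2, hO2'⟩ := tube (Set.Icc (max T T1) T') isCompact_Icc
    (fun g t => ‖(th (a t * g)).1 *ᵥ ic w‖) (cf' w) ε p2 (fun t ht => by
      rw [map_mul, mul_act]
      exact hT1 t ((le_max_right _ _).trans ht.1) _ hp2w hp2.2.le)
  have oN2 : IsOpen {g : SL(n, ℝ) | ‖g.1 *ᵥ ic v'‖ < ‖p2.1 *ᵥ ic v'‖ + 1} :=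
    isOpen_lt (cont_mulVec (ic v')).norm continuous_const
  have oU2 := (oU1.inter hO2).inter oN2
  obtain ⟨p3, hp3, hp3v, hp3x⟩ := H2 _ (oU2.mem_nhds ⟨⟨hp2, hpO2⟩, by simp⟩)
  have oZ : IsOpen {g : SL(n, ℝ) | (ρ g).1 *ᵥ x ∉ con (fun t => ρ (a t))} :=
    ((con (fun t => ρ (a t))).closed_of_finiteDimensional.isOpen_compl).preimage
      ((cont_mulVec x).comp hρ)
  obtain ⟨C', hC', hpC', hCU⟩ := exists_compact_subset (oU2.inter oZ) ⟨hp3, hp3x⟩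
  refine ⟨v', C', T', ⟨hv', hC', ⟨p3, hpC', hp3v⟩, ?_⟩, ?_, le_max_left _ _, ?_, fun g hg => (hCU hg).2⟩
  · intro g hg hgv t ht
    rw [mul_act]
    refine hT2 t (le_trans ?_ ht) _ hgv (hCU hg).1.2.le
    exact (le_max_right _ _).trans (le_max_right _ _)
  · intro g hg
    exact interior_subset (hCU hg).1.1.1.1.1
  · intro g hg t h1 h2
    rcases le_total t (max T T1) with h3 | h3
    · exact ⟨v, hv, Or.inl (hO1' g (hCU hg).1.1.1.1.2 t ⟨h1, h3⟩)⟩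
    · exact ⟨w, hw, Or.inr (hO2' g (hCU hg).1.1.2 t ⟨h3, h2⟩)⟩

theorem init {n : ℕ} (hn : 3 ≤ n) (a : ℝ → SL(n, ℝ)) (hE1 : con a ≠ ⊥) (ε : ℝ) (hε : 0 < ε) :
    ∃ v C T, Good a ε v C T := by
  obtain ⟨e1, he1, he10⟩ := Submodule.exists_mem_ne_zero_of_ne_bot hE1
  have i0 : Fin n := ⟨0, by omega⟩
  have hv : (Pi.single i0 1 : Fin n → ℤ) ≠ 0 := by
    intro h; have := congrFun h i0; simp at this
  obtain ⟨p, -, hp⟩ := trans0 hn (ic_ne hv) he10 (w := 0) (by simp) (by simp)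
  obtain ⟨T, hT⟩ := con_unif a (‖p.1 *ᵥ ic (Pi.single i0 1 : Fin n → ℤ)‖ + 1) ε hε
  have oN : IsOpen {g : SL(n, ℝ) | ‖g.1 *ᵥ ic (Pi.single i0 1)‖ < ‖p.1 *ᵥ ic (Pi.single i0 1)‖ + 1} :=
    isOpen_lt (cont_mulVec _).norm continuous_const
  obtain ⟨C, hC, hpC, hCU⟩ := exists_compact_subset oN (show p ∈ _ by simp)
  refine ⟨_, C, T, hv, hC, ⟨p, hpC, by rw [hp]; exact he1⟩, fun g hg hgv t ht => ?_⟩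
  rw [mul_act]
  exact hT t ht _ hgv (hCU hg).le

theorem main {n : ℕ} (hn : 3 ≤ n) (a : ℝ → SL(n, ℝ)) (ha : Continuous a) (hE1 : con a ≠ ⊥)
    (hE2 : con (fun t => th (a t)) ≠ ⊥) :
    ∃ g : SL(n, ℝ), (∀ ε > 0, ∀ᶠ t in atTop, Short ε (a t * g)) ∧
      ∀ (l : ℕ) (ρ : Rep n l) (v : Fin l → ℤ), v ≠ 0 → (ρ.1 g).1 *ᵥ ic v ∉ con (fun t => ρ.1 (a t)) := by
  have : ∀ l, Countable (Rep n l) := rep_countable hn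
  let I := Σ l : ℕ, Rep n l × {v : Fin l → ℤ // v ≠ 0}
  have hI : Nonempty I := ⟨⟨1, ⟨⟨1, continuous_const, fun γ _ => one_mem _⟩, ⟨1, one_ne_zero⟩⟩⟩⟩
  obtain ⟨e, he⟩ := exists_surjective_nat I
  have hε : ∀ k : ℕ, (0 : ℝ) < 1 / ((k : ℝ) + 1) := fun k => by positivity
  let S : ℕ → Type := fun k => {s : (Fin n → ℤ) × Set SL(n, ℝ) × ℝ //
    Good a (1 / ((k : ℝ) + 1)) s.1 s.2.1 s.2.2}
  have hstep : ∀ k (s : S k), ∃ s' : S (k + 1), s'.1.2.1 ⊆ s.1.2.1 ∧ s.1.2.2 + 1 ≤ s'.1.2.2 ∧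
      (∀ g ∈ s'.1.2.1, ∀ t, s.1.2.2 ≤ t → t ≤ s'.1.2.2 → Short (1 / ((k : ℝ) + 1)) (a t * g)) ∧
      ∀ g ∈ s'.1.2.1, ((e k).2.1.1 g).1 *ᵥ ic (e k).2.2.1 ∉ con (fun t => (e k).2.1.1 (a t)) := by
    intro k s
    obtain ⟨v', C', T', h1, h2⟩ := step hn a ha hE2 (e k).2.1.1 (e k).2.1.2.1 (ic (e k).2.2.1)
      (ic_ne (e k).2.2.2) _ _ (hε k) (hε (k + 1)) _ _ _ s.2
    exact ⟨⟨(v', C', T'), h1⟩, h2⟩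
  choose nx hnx using hstep
  obtain ⟨v0, C0, T0, h0⟩ := init hn a hE1 _ (hε 0)
  let s : ∀ k, S k := fun k => Nat.rec ⟨(v0, C0, T0), h0⟩ (fun k s => nx k s) k
  have hs : ∀ k, s (k + 1) = nx k (s k) := fun k => rfl
  have P : ∀ k, (s (k+1)).1.2.1 ⊆ (s k).1.2.1 ∧ (s k).1.2.2 + 1 ≤ (s (k+1)).1.2.2 ∧
      (∀ g ∈ (s (k+1)).1.2.1, ∀ t, (s k).1.2.2 ≤ t → t ≤ (s (k+1)).1.2.2 →
        Short (1 / ((k : ℝ) + 1)) (a t * g)) ∧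
      ∀ g ∈ (s (k+1)).1.2.1, ((e k).2.1.1 g).1 *ᵥ ic (e k).2.2.1 ∉ con (fun t => (e k).2.1.1 (a t)) :=
    fun k => hnx k (s k)
  obtain ⟨g, hg⟩ : (⋂ k, (s k).1.2.1).Nonempty := by
    apply IsCompact.nonempty_iInter_of_sequence_nonempty_isCompact_isClosed
    · exact fun k => (P k).1
    · intro k
      obtain ⟨p, hp, -⟩ := (s k).2.2.2.1
      exact ⟨p, interior_subset hp⟩
    · exact (s 0).2.2.1
    · exact fun k => (s k).2.2.1.isClosed
  rw [Set.mem_iInter] at hg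
  refine ⟨g, ?_, ?_⟩
  · intro ε hε0
    obtain ⟨K, hK⟩ := exists_nat_one_div_lt hε0
    have key : ∀ m : ℕ, ∀ t, (s K).1.2.2 ≤ t → t ≤ (s (K + m)).1.2.2 → Short ε (a t * g) := by
      intro m
      induction m with
      | zero =>
        intro t h1 h2
        have h2' : t ≤ (s K).1.2.2 := h2
        obtain ⟨v, hv, hh⟩ := (P K).2.2.1 g (hg (K + 1)) t h1 (h2'.trans (by linarith [(P K).2.1]))
        exact ⟨v, hv, hh.imp (fun h => h.trans hK) (fun h => h.trans hK)⟩
      | succ m ih =>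
        intro t h1 h2
        rcases le_total t (s (K + m)).1.2.2 with h3 | h3
        · exact ih t h1 h3
        · obtain ⟨v, hv, hh⟩ := (P (K + m)).2.2.1 g (hg (K + m + 1)) t h3 h2
          have hlt : 1 / (((K + m : ℕ) : ℝ) + 1) < ε := by
            refine lt_of_le_of_lt ?_ hK
            apply one_div_le_one_div_of_le (by positivity)
            push_cast; linarith [(Nat.cast_nonneg m : (0 : ℝ) ≤ m)]
          exact ⟨v, hv, hh.imp (fun h => h.trans hlt) (fun h => h.trans hlt)⟩
    have grow : ∀ m : ℕ, (s K).1.2.2 + m ≤ (s (K + m)).1.2.2 := by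
      intro m
      induction m with
      | zero => simp
      | succ m ih =>
        have := (P (K + m)).2.1
        push_cast
        have e : K + (m + 1) = K + m + 1 := rfl
        rw [e]
        linarith
    filter_upwards [eventually_ge_atTop (s K).1.2.2] with t ht
    obtain ⟨m, hm⟩ := exists_nat_ge (t - (s K).1.2.2)
    exact key m t ht (by linarith [grow m])
  · intro l ρ v hv
    obtain ⟨k, hk⟩ := he ⟨l, (ρ, ⟨v, hv⟩)⟩
    have := (P k).2.2.2 g (hg (k + 1))
    rw [hk] at this
    exact this

end Dani

/-- **Dani**: for `n ≥ 3` and any nontrivial ℝ-diagonalizable one-parameter subgroup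
`a(t)` of `G = SL(n,ℝ)`, there are orbits of `a(t)` on `G/SL(n,ℤ)` that diverge to
infinity but are *not* explained by a rational representation sending an integer
vector to `0`. -/
theorem dani_nondegenerate_divergent_orbit (n : ℕ) (hn : 3 ≤ n)
    (a : ℝ → SL(n, ℝ))
    (ha_hom : ∀ s t : ℝ, a (s + t) = a s * a t) (ha_cont : Continuous a)
    (ha_nontriv : ∃ t : ℝ, a t ≠ 1)
    (ha_diag : ∀ t : ℝ, ∃ (P : GL (Fin n) ℝ) (d : Fin n → ℝ),
      (a t : Matrix (Fin n) (Fin n) ℝ) =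
        (P : Matrix (Fin n) (Fin n) ℝ) * Matrix.diagonal d *
          ((P⁻¹ : GL (Fin n) ℝ) : Matrix (Fin n) (Fin n) ℝ)) :
    ∃ g : SL(n, ℝ),
      Tendsto (fun t : ℝ => ((a t * g : SL(n, ℝ)) : SL(n, ℝ) ⧸ SLZ n))
        atTop (cocompact (SL(n, ℝ) ⧸ SLZ n)) ∧
      ¬ ∃ (ℓ : ℕ) (ρ : SL(n, ℝ) →* SL(ℓ, ℝ)) (v : Fin ℓ → ℤ),
          1 ≤ ℓ ∧ Continuous ρ ∧ (∀ γ ∈ SLZ n, ρ γ ∈ SLZ ℓ) ∧ v ≠ 0 ∧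
          Tendsto
            (fun t : ℝ =>
              (ρ (a t * g) : Matrix (Fin ℓ) (Fin ℓ) ℝ) *ᵥ (fun i => (v i : ℝ)))
            atTop (𝓝 0) := by
  have hdiag : ∀ t, ∃ (P Q : Matrix (Fin n) (Fin n) ℝ) (d : Fin n → ℝ), P * Q = 1 ∧ Q * P = 1 ∧
      (a t).1 = P * Matrix.diagonal d * Q := by
    intro t
    obtain ⟨P, d, h⟩ := ha_diag t
    exact ⟨P.1, (P⁻¹).1, d, Units.mul_inv P, Units.inv_mul P, h⟩
  have hE1 := Dani.exists_contr a ha_hom ha_cont ha_nontriv hdiag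
  have hE2 : Dani.con (fun t => Dani.th (a t)) ≠ ⊥ := by
    apply Dani.exists_contr (fun t => Dani.th (a t))
    · intro s t
      simp only [ha_hom, map_mul]
    · exact Dani.cont_th.comp ha_cont
    · obtain ⟨t, ht⟩ := ha_nontriv
      refine ⟨t, fun h => ht ?_⟩
      rw [← Dani.th_th (a t)]
      rw [h, map_one]
    · intro t
      obtain ⟨P, Q, d, h1, h2, h3⟩ := hdiag (-t)
      refine ⟨Qᵀ, Pᵀ, d, ?_, ?_, ?_⟩
      · rw [← Matrix.transpose_mul, h1, Matrix.transpose_one]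
      · rw [← Matrix.transpose_mul, h2, Matrix.transpose_one]
      · show (Dani.th (a t)).1 = _
        rw [Dani.th_val, ← (Dani.one_param a ha_hom).2, h3, Matrix.transpose_mul,
          Matrix.transpose_mul, Matrix.diagonal_transpose, Matrix.mul_assoc]
  obtain ⟨g, h1, h2⟩ := Dani.main hn a ha_cont hE1 hE2
  refine ⟨g, Dani.diverge (fun t => a t * g) h1, ?_⟩
  rintro ⟨l, ρ, v, _, hρ, hΓ, hv, ht⟩
  refine h2 l ⟨ρ, hρ, hΓ⟩ v hv ?_
  rw [Dani.mem_con]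
  refine ht.congr fun t => ?_
  rw [map_mul]
  exact Dani.mul_act _ _ _
end

section
/- Let G = SL(2,ℝ), let Γ be a discrete subgroup of G such that G/Γ is compact, and let u(t) = [[1,t],[0,1]] be the horocycle one-parameter subgroup. Then the horocycle flow on G/Γ is uniquely ergodic: if μ and ν are Borel probability measures on G/Γ, each invariant under left translation by u(t) for every t ∈ ℝ, then μ = ν. -/
open Matrix MatrixGroups Filter MeasureTheory

noncomputable instance {n : ℕ} : MeasurableSpace (Matrix.SpecialLinearGroup (Fin n) ℝ) :=
  borel _

instance {n : ℕ} : BorelSpace (Matrix.SpecialLinearGroup (Fin n) ℝ) := ⟨rfl⟩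

/-- The horocycle one-parameter subgroup `u(t) = [[1,t],[0,1]]` of `SL(2,ℝ)`. -/
def horocycle (t : ℝ) : SL(2, ℝ) :=
  ⟨!![1, t; 0, 1], by simp [Matrix.det_fin_two_of]⟩

theorem hue_exists_fundDom {G : Type*} [Group G] [TopologicalSpace G] [IsTopologicalGroup G]
    [T2Space G] [LocallyCompactSpace G] [MeasurableSpace G]
    [BorelSpace G] (Γ : Subgroup G) [DiscreteTopology Γ] [CompactSpace (G ⧸ Γ)]
    (ν : Measure G) [IsFiniteMeasureOnCompacts ν]
    [ν.IsMulLeftInvariant] :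
    ∃ F : Set G, MeasurableSet F ∧ IsFundamentalDomain Γ.op F ν ∧ ν F < ⊤ := by
  have hπ : Continuous (QuotientGroup.mk : G → G ⧸ Γ) := QuotientGroup.continuous_mk
  have hπo : IsOpenMap (QuotientGroup.mk : G → G ⧸ Γ) := QuotientGroup.isOpenMap_coe
  obtain ⟨W, hWo, h1W, hWc, hWΓ⟩ : ∃ W : Set G, IsOpen W ∧ (1 : G) ∈ W ∧ ν W < ⊤ ∧
      ∀ a ∈ W, ∀ b ∈ W, a⁻¹ * b ∈ Γ → a = b := by
    have h1 : ∃ O : Set G, IsOpen O ∧ (1 : G) ∈ O ∧ ∀ g ∈ O, g ∈ Γ → g = 1 := by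
      obtain ⟨O, hO, hO'⟩ := isOpen_induced_iff.1 (isOpen_discrete ({1} : Set Γ))
      refine ⟨O, hO, ?_, ?_⟩
      · have : (1 : Γ) ∈ (Subtype.val ⁻¹' O : Set Γ) := by rw [hO']; rfl
        simpa using this
      · intro g hg hgΓ
        have : (⟨g, hgΓ⟩ : Γ) ∈ (Subtype.val ⁻¹' O : Set Γ) := hg
        rw [hO'] at this
        simpa using congrArg Subtype.val this
    obtain ⟨O, hO, h1O, hOΓ⟩ := h1
    have h2 : ∀ᶠ p : G × G in nhds (1, 1), p.1⁻¹ * p.2 ∈ O := by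
      have : ContinuousAt (fun p : G × G => p.1⁻¹ * p.2) (1, 1) := by fun_prop
      exact this.eventually (by simpa using hO.mem_nhds h1O)
    rw [nhds_prod_eq] at h2
    obtain ⟨T, hT, hT'⟩ := (eventually_prod_self_iff (r := fun a b : G => a⁻¹ * b ∈ O)).1 h2
    obtain ⟨K, hK, hK1⟩ := exists_compact_mem_nhds (1 : G)
    obtain ⟨W, hW, hWo, h1W⟩ := mem_nhds_iff.1 (inter_mem hT hK1)
    refine ⟨W, hWo, h1W, (measure_mono (hW.trans Set.inter_subset_right)).trans_lt
      hK.measure_lt_top, ?_⟩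
    intro a ha b hb hab
    have := hOΓ _ (hT' a (hW ha).1 b (hW hb).1) hab
    exact inv_mul_eq_one.1 this
  let V : G → Set G := fun x => (fun y => x⁻¹ * y) ⁻¹' W
  have hVo : ∀ x, IsOpen (V x) := fun x => hWo.preimage (by fun_prop)
  have hxV : ∀ x, x ∈ V x := fun x => by simpa [V] using h1W
  have hVν : ∀ x, ν (V x) < ⊤ := fun x => by
    simpa only [V, measure_preimage_mul] using hWc
  have hVΓ : ∀ x, ∀ a ∈ V x, ∀ b ∈ V x, a⁻¹ * b ∈ Γ → a = b := by
    intro x a ha b hb hab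
    have := hWΓ _ ha _ hb (by simpa [mul_assoc] using hab)
    simpa using this
  obtain ⟨t, ht⟩ := isCompact_univ.elim_finite_subcover
    (fun x : G => (QuotientGroup.mk '' V x : Set (G ⧸ Γ))) (fun x => hπo _ (hVo x)) (by
      intro q _
      obtain ⟨x, rfl⟩ := QuotientGroup.mk_surjective q
      exact Set.mem_iUnion.2 ⟨x, x, hxV x, rfl⟩)
  let e := t.equivFin.symm
  let P : Fin t.card → Set G := fun i => (QuotientGroup.mk : G → G ⧸ Γ) ⁻¹' (QuotientGroup.mk '' V (e i))
  have hPo : ∀ i, IsOpen (P i) := fun i => (hπo _ (hVo _)).preimage hπ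
  have hPcov : ∀ x, ∃ i, x ∈ P i := by
    intro x
    have := ht (Set.mem_univ (x : G ⧸ Γ))
    simp only [Set.mem_iUnion] at this
    obtain ⟨y, hy, hxy⟩ := this
    exact ⟨t.equivFin ⟨y, hy⟩, by simpa [P, e] using hxy⟩
  have hPinv : ∀ i x (γ : Γ.op), γ • x ∈ P i ↔ x ∈ P i := by
    intro i x γ
    have : ((γ • x : G) : G ⧸ Γ) = x := by
      obtain ⟨γ, hγ⟩ := γ
      rw [QuotientGroup.eq]
      change (x * γ.unop)⁻¹ * x ∈ Γ
      simpa using hγ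
    simp only [P, Set.mem_preimage, this]
  let F : Set G := ⋃ i, (V (e i) \ ⋃ j, ⋃ (_ : j < i), P j)
  have hF : MeasurableSet F := by
    refine MeasurableSet.iUnion fun i => (hVo _).measurableSet.diff ?_
    exact MeasurableSet.iUnion fun j => MeasurableSet.iUnion fun _ => (hPo j).measurableSet
  refine ⟨F, hF, IsFundamentalDomain.mk' hF.nullMeasurableSet ?_, ?_⟩
  · intro x
    have hmin : ∃ i, x ∈ P i ∧ ∀ j < i, x ∉ P j := by
      obtain ⟨i, hi, hi'⟩ := WellFounded.has_min (wellFounded_lt (α := Fin t.card)) {i | x ∈ P i} (hPcov x)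
      exact ⟨i, hi, fun j hj hx => hi' j hx hj⟩
    obtain ⟨i, hi, hi'⟩ := hmin
    have huniq : ∀ γ : Γ.op, γ • x ∈ F → γ • x ∈ V (e i) := by
      intro γ hγ
      obtain ⟨k, hk, hk'⟩ := Set.mem_iUnion.1 hγ
      simp only [Set.mem_iUnion, not_exists, hPinv] at hk'
      have hkP : x ∈ P k := (hPinv k x γ).1 ⟨_, hk, rfl⟩
      rcases lt_trichotomy i k with h | h | h
      · exact absurd hi (hk' i h)
      · rwa [h]
      · exact absurd hkP (hi' k h)
    obtain ⟨y, hy, hyx⟩ := hi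
    refine ⟨⟨MulOpposite.op (x⁻¹ * y), ?_⟩, ?_, ?_⟩
    · exact QuotientGroup.eq.1 hyx.symm
    · refine Set.mem_iUnion.2 ⟨i, ?_, ?_⟩
      · change x * (x⁻¹ * y) ∈ _
        simpa using hy
      · simp only [Set.mem_iUnion, not_exists, hPinv]
        exact hi'
    · intro γ hγ
      have h1 := huniq γ hγ
      obtain ⟨γ, hγ'⟩ := γ
      have h1 : x * γ.unop ∈ V (e i) := h1
      have := hVΓ _ _ h1 _ hy (by
        have := QuotientGroup.eq.1 hyx.symm
        rw [_root_.mul_inv_rev, mul_assoc]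
        exact Γ.mul_mem (Γ.inv_mem hγ') this)
      apply Subtype.ext
      apply MulOpposite.unop_injective
      change γ.unop = x⁻¹ * y
      rw [← this]; simp
  · refine (measure_mono (Set.iUnion_mono fun i => Set.sdiff_subset)).trans_lt ?_
    exact (measure_iUnion_le _).trans_lt (by
      rw [tsum_fintype]
      exact ENNReal.sum_lt_top.2 fun i _ => hVν _)

open scoped Pointwise in
theorem hue_exists_inv_measure {G : Type*} [Group G] [TopologicalSpace G] [IsTopologicalGroup G]
    [T2Space G] [LocallyCompactSpace G] [SecondCountableTopology G] [MeasurableSpace G]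
    [BorelSpace G] (Γ : Subgroup G) [DiscreteTopology Γ] [CompactSpace (G ⧸ Γ)]
    [BorelSpace (G ⧸ Γ)]
    (ν : Measure G) [ν.IsHaarMeasure] [ν.IsMulRightInvariant] :
    ∃ m : Measure (G ⧸ Γ), IsFiniteMeasure m ∧ m.IsOpenPosMeasure ∧
      ∀ g : G, MeasurePreserving (fun x : G ⧸ Γ => g • x) m m := by
  obtain ⟨F, hFm, hF, hFν⟩ := hue_exists_fundDom Γ ν
  have hπ : Continuous (QuotientGroup.mk : G → G ⧸ Γ) := QuotientGroup.continuous_mk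
  have : Countable Γ := by
    exact TopologicalSpace.separableSpace_iff_countable.1 inferInstance
  have : Countable Γ.op := Γ.equivOp.symm.countable_iff.2 inferInstance
  have hinv : ∀ (A : Set (G ⧸ Γ)) (γ : Γ.op), (fun x : G => γ • x) ⁻¹' (QuotientGroup.mk ⁻¹' A)
      = QuotientGroup.mk ⁻¹' A := by
    intro A γ
    ext x
    have : ((γ • x : G) : G ⧸ Γ) = x := by
      obtain ⟨γ, hγ⟩ := γ
      rw [QuotientGroup.eq]
      change (x * γ.unop)⁻¹ * x ∈ Γ
      simpa using hγ
    simp only [Set.mem_preimage, this]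
  refine ⟨(ν.restrict F).map QuotientGroup.mk, ?_, ⟨?_⟩, ?_⟩
  · have : IsFiniteMeasure (ν.restrict F) := ⟨by simpa using hFν⟩
    infer_instance
  · intro U hU hne h0
    rw [Measure.map_apply hπ.measurable hU.measurableSet,
      Measure.restrict_apply (hπ.measurable hU.measurableSet)] at h0
    have h1 := hF.measure_zero_of_invariant _ (fun γ => by
      rw [← Set.preimage_smul_inv]; exact hinv U γ⁻¹) h0
    obtain ⟨q, hq⟩ := hne
    obtain ⟨x, rfl⟩ := QuotientGroup.mk_surjective q
    exact ((hU.preimage hπ).measure_pos ν ⟨x, hq⟩).ne' h1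
  · intro g
    have hg : Measurable (fun x : G ⧸ Γ => g • x) := (continuous_const_smul g).measurable
    refine ⟨hg, Measure.ext fun A hA => ?_⟩
    rw [Measure.map_apply hg hA, Measure.map_apply hπ.measurable (hg hA),
      Measure.map_apply hπ.measurable hA, Measure.restrict_apply (hπ.measurable (hg hA)),
      Measure.restrict_apply (hπ.measurable hA),
      hF.measure_set_eq (hF.smul_of_comm g) (hπ.measurable hA) (hinv A)]
    rw [← measure_preimage_mul ν g (QuotientGroup.mk ⁻¹' A ∩ g • F)]
    congr 1
    ext x
    simp [Set.mem_smul_set_iff_inv_smul_mem]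
instance hue_t2 : T2Space SL(2, ℝ) :=
  (SpecialLinearGroup.isClosedEmbedding_val (n := Fin 2) (R := ℝ)).isEmbedding.t2Space

instance hue_lcM : LocallyCompactSpace (Matrix (Fin 2) (Fin 2) ℝ) :=
  inferInstanceAs (LocallyCompactSpace (Fin 2 → Fin 2 → ℝ))

instance hue_scM : SecondCountableTopology (Matrix (Fin 2) (Fin 2) ℝ) :=
  inferInstanceAs (SecondCountableTopology (Fin 2 → Fin 2 → ℝ))

instance hue_lc : LocallyCompactSpace SL(2, ℝ) :=
  (SpecialLinearGroup.isClosedEmbedding_val (n := Fin 2) (R := ℝ)).locallyCompactSpace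

instance hue_sc : SecondCountableTopology SL(2, ℝ) :=
  (SpecialLinearGroup.isClosedEmbedding_val (n := Fin 2) (R := ℝ)).isEmbedding.secondCountableTopology

instance hue_tg : IsTopologicalGroup SL(2, ℝ) := SpecialLinearGroup.topologicalGroup

/-- lower triangular -/
noncomputable def hueB (a r : ℝ) (ha : a ≠ 0) : SL(2, ℝ) :=
  ⟨!![a, 0; r, a⁻¹], by simp [Matrix.det_fin_two_of, ha]⟩

/-- diagonal -/
noncomputable def hueA (t : ℝ) : SL(2, ℝ) := hueB (Real.exp t) 0 (Real.exp_ne_zero t)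

/-- opposite horocycle -/
noncomputable def hueV (r : ℝ) : SL(2, ℝ) := hueB 1 r one_ne_zero

theorem hue_ext {g h : SL(2, ℝ)} (h1 : g.1 0 0 = h.1 0 0) (h2 : g.1 0 1 = h.1 0 1)
    (h3 : g.1 1 0 = h.1 1 0) (h4 : g.1 1 1 = h.1 1 1) : g = h := by
  apply Subtype.ext
  ext i j
  fin_cases i <;> fin_cases j <;> assumption

theorem hue_mul (g h : SL(2, ℝ)) (i j : Fin 2) : (g * h).1 i j = g.1 i 0 * h.1 0 j + g.1 i 1 * h.1 1 j := by
  refine (congrFun (congrFun (Matrix.SpecialLinearGroup.coe_mul g h) i) j).trans ?_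
  rw [Matrix.mul_apply, Fin.sum_univ_two]

theorem hue_B00 (a r : ℝ) (ha : a ≠ 0) : (hueB a r ha).1 0 0 = a := rfl
theorem hue_B01 (a r : ℝ) (ha : a ≠ 0) : (hueB a r ha).1 0 1 = 0 := rfl
theorem hue_B10 (a r : ℝ) (ha : a ≠ 0) : (hueB a r ha).1 1 0 = r := rfl
theorem hue_B11 (a r : ℝ) (ha : a ≠ 0) : (hueB a r ha).1 1 1 = a⁻¹ := rfl

theorem hue_A00 (t : ℝ) : (hueA t).1 0 0 = Real.exp t := rfl
theorem hue_A01 (t : ℝ) : (hueA t).1 0 1 = 0 := rfl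
theorem hue_A10 (t : ℝ) : (hueA t).1 1 0 = 0 := rfl
theorem hue_A11 (t : ℝ) : (hueA t).1 1 1 = (Real.exp t)⁻¹ := rfl

theorem hue_U00 (t : ℝ) : (horocycle t).1 0 0 = 1 := rfl
theorem hue_U01 (t : ℝ) : (horocycle t).1 0 1 = t := rfl
theorem hue_U10 (t : ℝ) : (horocycle t).1 1 0 = 0 := rfl
theorem hue_U11 (t : ℝ) : (horocycle t).1 1 1 = 1 := rfl

theorem hue_one00  : (1 : SL(2, ℝ)).1 0 0 = 1 := rfl
theorem hue_one01  : (1 : SL(2, ℝ)).1 0 1 = 0 := rfl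
theorem hue_one10  : (1 : SL(2, ℝ)).1 1 0 = 0 := rfl
theorem hue_one11  : (1 : SL(2, ℝ)).1 1 1 = 1 := rfl

theorem hue_V00 (r : ℝ) : (hueV r).1 0 0 = 1 := rfl
theorem hue_V01 (r : ℝ) : (hueV r).1 0 1 = 0 := rfl
theorem hue_V10 (r : ℝ) : (hueV r).1 1 0 = r := rfl
theorem hue_V11 (r : ℝ) : (hueV r).1 1 1 = 1 := inv_one

attribute [simp] hue_mul hue_B00 hue_B01 hue_B10 hue_B11 hue_A00 hue_A01 hue_A10 hue_A11 hue_U00 hue_U01 hue_U10 hue_U11 hue_V00 hue_V01 hue_V10 hue_V11 hue_one00 hue_one01 hue_one10 hue_one11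

theorem hue_det (g : SL(2, ℝ)) : g.1 0 0 * g.1 1 1 - g.1 0 1 * g.1 1 0 = 1 := by
  rw [← Matrix.det_fin_two]; exact g.2

theorem hue_A_add (s t : ℝ) : hueA (s + t) = hueA s * hueA t := by
  apply hue_ext <;> simp [Real.exp_add, mul_comm]

theorem hue_A_zero : hueA 0 = 1 := by
  apply hue_ext <;> simp

theorem hue_U_add (s t : ℝ) : horocycle (s + t) = horocycle s * horocycle t := by
  apply hue_ext <;> simp [add_comm]

theorem hue_U_zero : horocycle 0 = 1 := by
  apply hue_ext <;> simp

theorem hue_A_U (t s : ℝ) :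
    hueA t * horocycle s = horocycle (Real.exp (2 * t) * s) * hueA t := by
  apply hue_ext <;> simp
  rw [two_mul, Real.exp_add]
  field_simp

theorem hue_A_B (t a r : ℝ) (ha : a ≠ 0) :
    hueA t * hueB a r ha = hueB a (Real.exp (-2 * t) * r) ha * hueA t := by
  have : Real.exp (-(2 * t)) = (Real.exp t)⁻¹ * (Real.exp t)⁻¹ := by
    rw [← Real.exp_neg, ← Real.exp_add]; ring_nf
  apply hue_ext <;> simp [this] <;> field_simp

theorem hue_U_mul (s : ℝ) (w : SL(2, ℝ)) (h : w.1 0 0 + s * w.1 1 0 ≠ 0) :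
    horocycle s * w = hueB (w.1 0 0 + s * w.1 1 0) (w.1 1 0) h *
      horocycle ((w.1 0 1 + s * w.1 1 1) / (w.1 0 0 + s * w.1 1 0)) := by
  have hd := hue_det w
  have h' : w.1 0 0 + w.1 1 0 * s ≠ 0 := by rwa [mul_comm (w.1 1 0)]
  apply hue_ext <;> simp
  · field_simp
  · field_simp
    linarith

theorem hue_gen (P : SL(2, ℝ) → Prop) (hmul : ∀ g h, P g → P h → P (g * h))
    (hU : ∀ t, P (horocycle t)) (hV : ∀ t, P (hueV t)) (g : SL(2, ℝ)) : P g := by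
  have key : ∀ g : SL(2, ℝ), g.1 1 0 ≠ 0 → P g := by
    intro g hc
    have hd := hue_det g
    have : g = horocycle ((g.1 0 0 - 1) / g.1 1 0) * (hueV (g.1 1 0) *
        horocycle ((g.1 1 1 - 1) / g.1 1 0)) := by
      apply hue_ext <;> simp
      · field_simp; ring
      · field_simp; linarith
      · field_simp; ring
    rw [this]
    exact hmul _ _ (hU _) (hmul _ _ (hV _) (hU _))
  by_cases hc : g.1 1 0 = 0
  · have hd := hue_det g
    have ha : g.1 0 0 ≠ 0 := by
      intro h; rw [h, hc] at hd; simp at hd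
    have : g = hueV (-1) * (hueV 1 * g) := by
      rw [← mul_assoc]
      have : hueV (-1) * hueV 1 = 1 := by
        apply hue_ext <;> simp
      rw [this, one_mul]
    rw [this]
    refine hmul _ _ (hV _) (key _ ?_)
    simpa [hc] using ha
  · exact key g hc

theorem hue_modular (g : SL(2, ℝ)) : Measure.modularCharacter g = 1 := by
  refine hue_gen (fun g => Measure.modularCharacter g = 1) ?_ ?_ ?_ g
  · intro g h hg hh
    rw [map_mul, hg, hh, one_mul]
  · intro t
    have h := congrArg Measure.modularCharacter (hue_A_U (Real.log 2 / 2) t)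
    rw [map_mul, map_mul, mul_comm] at h
    have h' := mul_right_cancel₀ (by
      exact (Measure.modularCharacterFun_pos (hueA (Real.log 2 / 2))).ne') h
    rw [mul_div_cancel₀ _ (two_ne_zero), Real.exp_log two_pos, two_mul, hue_U_add, map_mul] at h'
    have h0 : Measure.modularCharacter (horocycle t) ≠ 0 :=
      (Measure.modularCharacterFun_pos (horocycle t)).ne'
    exact mul_eq_left₀ h0 |>.1 h'.symm
  · intro t
    have h := congrArg Measure.modularCharacter (hue_A_B (- (Real.log 2 / 2)) 1 t one_ne_zero)
    rw [map_mul, map_mul, mul_comm] at h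
    have h' := mul_right_cancel₀ (by
      exact (Measure.modularCharacterFun_pos (hueA (-(Real.log 2 / 2)))).ne') h
    have e1 : -2 * -(Real.log 2 / 2) = Real.log 2 := by ring
    have e2 : hueB 1 (2 * t) one_ne_zero = hueV t * hueV t := by
      apply hue_ext <;> simp [two_mul]
    rw [e1, Real.exp_log two_pos, e2, map_mul] at h'
    have h0 : Measure.modularCharacter (hueV t) ≠ 0 :=
      (Measure.modularCharacterFun_pos (hueV t)).ne'
    exact mul_eq_left₀ h0 |>.1 h'.symm

theorem hue_haar_right : (Measure.haar : Measure SL(2, ℝ)).IsMulRightInvariant := by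
  refine ⟨fun g => ?_⟩
  rw [Measure.map_right_mul_eq_modularCharacterFun_smul]
  have : Measure.modularCharacterFun g = 1 := hue_modular g
  rw [this, one_smul]
theorem hue_change_var (ψ : ℝ → ℝ) (hψ : Continuous ψ) (C : ℝ) (hC : ∀ s, |ψ s| ≤ C)
    (p q r k η : ℝ) (hdet : p * k - q * r = 1) (hη : η ≤ 1 / 8) (hp : |p - 1| ≤ η) (hq : |q| ≤ η)
    (hr : |r| ≤ η) (hk : |k - 1| ≤ η) :
    |(∫ s in (0 : ℝ)..1, ψ ((q + s * k) / (p + s * r))) - ∫ s in (0 : ℝ)..1, ψ s| ≤ 16 * C * η := by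
  have hC0 : 0 ≤ C := (abs_nonneg _).trans (hC 0)
  have hη0 : 0 ≤ η := (abs_nonneg _).trans hq
  rw [abs_le] at hp hq hr hk
  have hsr : ∀ s ∈ Set.Icc (0 : ℝ) 1, |s * r| ≤ η := by
    intro s hs
    rw [abs_mul, abs_of_nonneg hs.1]
    have : |r| ≤ η := abs_le.2 hr
    nlinarith [hs.1, hs.2, abs_nonneg r]
  have hα : ∀ s ∈ Set.Icc (0 : ℝ) 1, 3 / 4 ≤ p + s * r := by
    intro s hs
    have := abs_le.1 (hsr s hs)
    linarith
  have hα1 : ∀ s ∈ Set.Icc (0 : ℝ) 1, |p + s * r - 1| ≤ 2 * η := by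
    intro s hs
    have := abs_le.1 (hsr s hs)
    rw [abs_le]; constructor <;> linarith
  let σ : ℝ → ℝ := fun s => (q + s * k) / (p + s * r)
  let σ' : ℝ → ℝ := fun s => 1 / (p + s * r) ^ 2
  have hI : Set.uIcc (0 : ℝ) 1 = Set.Icc 0 1 := Set.uIcc_of_le zero_le_one
  have hne : ∀ s ∈ Set.Icc (0 : ℝ) 1, p + s * r ≠ 0 := fun s hs => by
    have := hα s hs
    intro h; linarith
  have hσ : ∀ s ∈ Set.uIcc (0 : ℝ) 1, HasDerivAt σ (σ' s) s := by
    intro s hs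
    rw [hI] at hs
    have h1 : HasDerivAt (fun s : ℝ => q + s * k) k s := by
      simpa using ((hasDerivAt_id s).mul_const k).const_add q
    have h2 : HasDerivAt (fun s : ℝ => p + s * r) r s := by
      simpa using ((hasDerivAt_id s).mul_const r).const_add p
    have h3 := h1.div h2 (hne s hs)
    have h4 : σ' s = (k * (p + s * r) - (q + s * k) * r) / (p + s * r) ^ 2 := by
      change 1 / _ = _
      congr 1
      linarith
    rw [h4]
    exact h3
  have hσ'c : ContinuousOn σ' (Set.uIcc (0 : ℝ) 1) := by
    rw [hI]
    refine ContinuousOn.div (by fun_prop) (by fun_prop) ?_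
    intro s hs
    exact pow_ne_zero _ (hne s hs)
  have hσc : ContinuousOn σ (Set.uIcc (0 : ℝ) 1) := fun s hs => (hσ s hs).continuousAt.continuousWithinAt
  have hcv := intervalIntegral.integral_comp_mul_deriv' (g := ψ) hσ hσ'c hψ.continuousOn
  have hψσ : ContinuousOn (fun s => ψ (σ s)) (Set.uIcc (0 : ℝ) 1) := hψ.comp_continuousOn hσc
  have hsplit : (∫ s in (0 : ℝ)..1, ψ (σ s)) - ∫ s in (0 : ℝ)..1, ψ s =
      (∫ s in (0 : ℝ)..1, ψ (σ s) * (1 - σ' s)) +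
        ((∫ s in (σ 0)..0, ψ s) - ∫ s in (σ 1)..1, ψ s) := by
    have e1 : (∫ s in (0 : ℝ)..1, ψ (σ s) * (1 - σ' s)) =
        (∫ s in (0 : ℝ)..1, ψ (σ s)) - ∫ s in (σ 0)..(σ 1), ψ s := by
      have hi2 : IntervalIntegrable (fun x => (ψ ∘ σ) x * σ' x) volume 0 1 :=
        (hψσ.mul hσ'c).intervalIntegrable
      rw [← hcv, ← intervalIntegral.integral_sub hψσ.intervalIntegrable hi2]
      refine intervalIntegral.integral_congr fun s _ => ?_
      simp only [Function.comp]
      ring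
    rw [e1, ← intervalIntegral.integral_interval_sub_interval_comm
      (hψ.intervalIntegrable _ _) (hψ.intervalIntegrable _ _) (hψ.intervalIntegrable _ _)]
    ring
  have b1 : |∫ s in (0 : ℝ)..1, ψ (σ s) * (1 - σ' s)| ≤ 8 * C * η := by
    have := intervalIntegral.norm_integral_le_of_norm_le_const (a := (0 : ℝ)) (b := 1) (C := 8 * C * η)
      (f := fun s => ψ (σ s) * (1 - σ' s)) (by
        intro s hs
        rw [Set.uIoc_of_le zero_le_one] at hs
        have hs' : s ∈ Set.Icc (0 : ℝ) 1 := ⟨hs.1.le, hs.2⟩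
        have h1 := hα s hs'
        have h2 := hα1 s hs'
        rw [Real.norm_eq_abs, abs_mul]
        have h3 : |1 - σ' s| ≤ 8 * η := by
          set α := p + s * r with hαdef
          have e : 1 - σ' s = (α - 1) * (α + 1) / α ^ 2 := by
            simp only [σ', ← hαdef]
            have : α ≠ 0 := by intro h; linarith
            field_simp
            ring
          rw [e, abs_div, abs_mul, abs_of_pos (by positivity : 0 < α ^ 2),
            div_le_iff₀ (by positivity)]
          rw [abs_of_pos (by linarith : 0 < α + 1)]
          have h4 : α ≤ 5 / 4 := by have := (abs_le.1 h2).2; linarith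
          calc |α - 1| * (α + 1) ≤ (2 * η) * (9 / 4) := by
                apply mul_le_mul h2 (by linarith) (by linarith) (by linarith)
            _ ≤ 8 * η * α ^ 2 := by
                have h5 : 9 / 16 ≤ α ^ 2 := by nlinarith
                nlinarith [mul_le_mul_of_nonneg_left h5 hη0]
        calc |ψ (σ s)| * |1 - σ' s| ≤ C * (8 * η) :=
              mul_le_mul (hC _) h3 (abs_nonneg _) hC0
          _ = 8 * C * η := by ring)
    simpa using this
  have hbd : ∀ a b : ℝ, |∫ s in a..b, ψ s| ≤ C * |b - a| := fun a b => by
    have := intervalIntegral.norm_integral_le_of_norm_le_const (a := a) (b := b) (f := ψ) (C := C)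
      fun s _ => hC s
    exact this
  have b2 : |σ 0| ≤ 2 * η := by
    simp only [σ, zero_mul, add_zero]
    rw [abs_div, div_le_iff₀ (by rw [abs_pos]; intro h; linarith), abs_of_pos (by linarith : 0 < p)]
    have : |q| ≤ η := abs_le.2 hq
    nlinarith
  have b3 : |1 - σ 1| ≤ 6 * η := by
    have h1 := hα 1 (by simp)
    have e : 1 - σ 1 = ((p - 1) + r - q - (k - 1)) / (p + r) := by
      simp only [σ, one_mul] at h1 ⊢
      have : p + r ≠ 0 := by intro h; linarith
      field_simp
      ring
    rw [one_mul] at h1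
    rw [e, abs_div, abs_of_pos (by linarith : 0 < p + r), div_le_iff₀ (by linarith), abs_le]
    constructor <;> nlinarith
  have c2 := hbd (σ 0) 0
  have c3 := hbd (σ 1) 1
  rw [zero_sub, abs_neg] at c2
  change |(∫ s in (0 : ℝ)..1, ψ (σ s)) - ∫ s in (0 : ℝ)..1, ψ s| ≤ _
  rw [hsplit]
  have c2' := mul_le_mul_of_nonneg_left b2 hC0
  have c3' := mul_le_mul_of_nonneg_left b3 hC0
  calc _ ≤ |∫ s in (0 : ℝ)..1, ψ (σ s) * (1 - σ' s)| +
        (|∫ s in (σ 0)..0, ψ s| + |∫ s in (σ 1)..1, ψ s|) :=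
        (abs_add_le _ _).trans (add_le_add le_rfl (abs_sub _ _))
    _ ≤ 16 * C * η := by linarith

theorem hue_nhds_small (O : Set SL(2, ℝ)) (hO : O ∈ nhds 1) :
    ∃ δ : ℝ, 0 < δ ∧ ∀ w : SL(2, ℝ), |w.1 0 0 - 1| ≤ δ → |w.1 0 1| ≤ δ → |w.1 1 0| ≤ δ →
      |w.1 1 1 - 1| ≤ δ → w ∈ O := by
  obtain ⟨V, hV, hVO⟩ := mem_nhds_subtype _ _ _ |>.1 hO
  have hΦ : Continuous (fun p : ℝ × ℝ × ℝ × ℝ => (!![p.1, p.2.1; p.2.2.1, p.2.2.2] :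
      Matrix (Fin 2) (Fin 2) ℝ)) := by
    refine continuous_matrix fun i j => ?_
    fin_cases i <;> fin_cases j <;> simp <;> fun_prop
  have h1 : (fun p : ℝ × ℝ × ℝ × ℝ => (!![p.1, p.2.1; p.2.2.1, p.2.2.2] :
      Matrix (Fin 2) (Fin 2) ℝ)) ⁻¹' V ∈ nhds ((1, 0, 0, 1) : ℝ × ℝ × ℝ × ℝ) := by
    apply hΦ.continuousAt.preimage_mem_nhds
    convert hV using 2
    exact Matrix.one_fin_two.symm
  obtain ⟨ε, hε, hb⟩ := Metric.mem_nhds_iff.1 h1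
  refine ⟨ε / 2, half_pos hε, fun w ha hb' hc hd => ?_⟩
  apply hVO
  have : ((w.1 0 0, w.1 0 1, w.1 1 0, w.1 1 1) : ℝ × ℝ × ℝ × ℝ) ∈ Metric.ball ((1, 0, 0, 1) : ℝ × ℝ × ℝ × ℝ) ε := by
    have hh := half_lt_self hε
    simp only [Metric.mem_ball, Prod.dist_eq, Real.dist_eq, sub_zero, sup_lt_iff]
    exact ⟨ha.trans_lt hh, hb'.trans_lt hh, hc.trans_lt hh, hd.trans_lt hh⟩
  have h2 := hb this
  rw [Set.mem_preimage] at h2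
  have h3 : w.1 ∈ V := by
    rw [Matrix.eta_fin_two w.1]
    exact h2
  exact h3

theorem hue_cont_entry (i j : Fin 2) : Continuous (fun w : SL(2, ℝ) => w.1 i j) :=
  (continuous_subtype_val (p := fun A : Matrix (Fin 2) (Fin 2) ℝ => A.det = 1)).matrix_elem i j

theorem hue_small_nhds (δ : ℝ) (hδ : 0 < δ) : ∀ᶠ w : SL(2, ℝ) in nhds 1,
    |w.1 0 0 - 1| ≤ δ ∧ |w.1 0 1| ≤ δ ∧ |w.1 1 0| ≤ δ ∧ |w.1 1 1 - 1| ≤ δ := by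
  have key : ∀ i j, ∀ᶠ w : SL(2, ℝ) in nhds 1, |w.1 i j - (1 : SL(2, ℝ)).1 i j| ≤ δ := by
    intro i j
    have := (hue_cont_entry i j).tendsto 1
    have := Metric.tendsto_nhds.1 this δ hδ
    filter_upwards [this] with w hw
    exact (Real.dist_eq _ _ ▸ hw).le
  filter_upwards [key 0 0, key 0 1, key 1 0, key 1 1] with w h1 h2 h3 h4
  refine ⟨h1, ?_, ?_, h4⟩
  · simpa using h2
  · simpa using h3

theorem hue_unif {Γ : Subgroup SL(2, ℝ)} [CompactSpace (SL(2, ℝ) ⧸ Γ)] (f : SL(2, ℝ) ⧸ Γ → ℝ)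
    (hf : Continuous f) (ε : ℝ) (hε : 0 < ε) :
    ∀ᶠ o : SL(2, ℝ) in nhds 1, ∀ x, |f (o • x) - f x| ≤ ε := by
  have := (isCompact_univ (X := SL(2, ℝ) ⧸ Γ)).eventually_forall_of_forall_eventually
    (x₀ := (1 : SL(2, ℝ))) (P := fun o x => |f (o • x) - f x| ≤ ε) ?_
  · simpa using this
  · intro x _
    have hc : Continuous (fun z : SL(2, ℝ) × (SL(2, ℝ) ⧸ Γ) => |f (z.1 • z.2) - f z.2|) := by
      fun_prop
    have := hc.tendsto (1, x)
    simp only [one_smul, sub_self, abs_zero] at this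
    exact (this.eventually_lt_const hε).mono fun _ h => h.le

theorem hue_unif_entries {Γ : Subgroup SL(2, ℝ)} [CompactSpace (SL(2, ℝ) ⧸ Γ)]
    (f : SL(2, ℝ) ⧸ Γ → ℝ)
    (hf : Continuous f) (ε : ℝ) (hε : 0 < ε) :
    ∃ δ : ℝ, 0 < δ ∧ ∀ w : SL(2, ℝ), |w.1 0 0 - 1| ≤ δ → |w.1 0 1| ≤ δ → |w.1 1 0| ≤ δ →
      |w.1 1 1 - 1| ≤ δ → ∀ x, |f (w • x) - f x| ≤ ε :=
  hue_nhds_small _ (hue_unif f hf ε hε)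

theorem hue_U_cont : Continuous horocycle := by
  refine Continuous.subtype_mk (f := fun t : ℝ => (!![1, t; 0, 1] : Matrix (Fin 2) (Fin 2) ℝ)) ?_ _
  refine continuous_matrix fun i j => ?_
  fin_cases i <;> fin_cases j <;> simp <;> fun_prop

/-- the averages -/
noncomputable def hueF {Γ : Subgroup SL(2, ℝ)} (f : SL(2, ℝ) ⧸ Γ → ℝ) (t : ℝ)
    (x : SL(2, ℝ) ⧸ Γ) : ℝ := ∫ s in (0:ℝ)..1, f (hueA t • horocycle s • x)

theorem hue_integrand_cont {Γ : Subgroup SL(2, ℝ)} (f : SL(2, ℝ) ⧸ Γ → ℝ)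
    (hf : Continuous f) (t : ℝ) : Continuous (fun z : (SL(2, ℝ) ⧸ Γ) × ℝ => f (hueA t • horocycle z.2 • z.1)) := by
  have := hue_U_cont
  fun_prop

theorem hue_int_cont1 {Γ : Subgroup SL(2, ℝ)} (f : SL(2, ℝ) ⧸ Γ → ℝ)
    (hf : Continuous f) (t : ℝ) (x : SL(2, ℝ) ⧸ Γ) :
    Continuous (fun s : ℝ => f (hueA t • horocycle s • x)) := by
  have := hue_U_cont
  fun_prop

theorem hue_F_cont {Γ : Subgroup SL(2, ℝ)} (f : SL(2, ℝ) ⧸ Γ → ℝ)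
    (hf : Continuous f) (t : ℝ) : Continuous (hueF f t) :=
  intervalIntegral.continuous_parametric_intervalIntegral_of_continuous'
    (f := fun x s => f (hueA t • horocycle s • x)) (hue_integrand_cont f hf t) 0 1

theorem hue_alpha (w : SL(2, ℝ)) (η : ℝ) (hη1 : η ≤ 1 / 8) (hp : |w.1 0 0 - 1| ≤ η)
    (hr : |w.1 1 0| ≤ η) (s : ℝ) (hs : s ∈ Set.Icc (0:ℝ) 1) :
    |w.1 0 0 + s * w.1 1 0 - 1| ≤ 2 * η ∧ 3 / 4 ≤ w.1 0 0 + s * w.1 1 0 := by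
  have hα : ∀ s ∈ Set.Icc (0:ℝ) 1, |w.1 0 0 + s * w.1 1 0 - 1| ≤ 2 * η := by
    intro s hs
    have h1 : |s * w.1 1 0| ≤ η := by
      rw [abs_mul, abs_of_nonneg hs.1]
      nlinarith [hs.2, abs_nonneg (w.1 1 0)]
    calc _ = |(w.1 0 0 - 1) + s * w.1 1 0| := by ring_nf
      _ ≤ _ := abs_add_le _ _
      _ ≤ _ := by linarith
  have hα0 : ∀ s ∈ Set.Icc (0:ℝ) 1, 3 / 4 ≤ w.1 0 0 + s * w.1 1 0 := by
    intro s hs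
    have := (abs_le.1 (hα s hs)).1
    linarith
  exact ⟨hα s hs, hα0 s hs⟩

theorem hue_equi_pt {Γ : Subgroup SL(2, ℝ)} (f : SL(2, ℝ) ⧸ Γ → ℝ) (ε δ η : ℝ) (hδ : 0 < δ)
    (hw : ∀ w : SL(2, ℝ), |w.1 0 0 - 1| ≤ δ → |w.1 0 1| ≤ δ → |w.1 1 0| ≤ δ →
      |w.1 1 1 - 1| ≤ δ → ∀ x, |f (w • x) - f x| ≤ ε / 2)
    (hη0 : 0 < η) (hη1 : η ≤ 1 / 8) (hη2 : η ≤ δ / 4)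
    (w : SL(2, ℝ)) (hp : |w.1 0 0 - 1| ≤ η) (hr : |w.1 1 0| ≤ η)
    (t : ℝ) (ht : 0 ≤ t) (x : SL(2, ℝ) ⧸ Γ)
    (s : ℝ) (hs : s ∈ Set.Icc (0:ℝ) 1) : |f (hueA t • horocycle s • w • x) -
      f (hueA t • horocycle ((w.1 0 1 + s * w.1 1 1) / (w.1 0 0 + s * w.1 1 0)) • x)| ≤ ε / 2 := by
  have hα := fun s hs => (hue_alpha w η hη1 hp hr s hs).1
  have hα0 := fun s hs => (hue_alpha w η hη1 hp hr s hs).2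
  have h0 : w.1 0 0 + s * w.1 1 0 ≠ 0 := by linarith [hα0 s hs]
  rw [smul_smul (horocycle s), hue_U_mul s w h0, ← smul_smul, smul_smul (hueA t), hue_A_B,
    ← smul_smul]
  apply hw
  · simp only [hue_B00]; linarith [hα s hs]
  · simp [hδ.le]
  · simp only [hue_B10]
    rw [abs_mul, abs_of_pos (Real.exp_pos _)]
    have : Real.exp (-2 * t) ≤ 1 := Real.exp_le_one_iff.2 (by linarith)
    nlinarith [abs_nonneg (w.1 1 0)]
  · simp only [hue_B11]
    set α := w.1 0 0 + s * w.1 1 0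
    have : α⁻¹ - 1 = (1 - α) / α := by field_simp
    rw [this, abs_div, abs_sub_comm, abs_of_pos (a := α) (by linarith [hα0 s hs])]
    rw [div_le_iff₀ (by linarith [hα0 s hs])]
    nlinarith [hα s hs, hα0 s hs]
  
theorem hue_equi_aux {Γ : Subgroup SL(2, ℝ)} (f : SL(2, ℝ) ⧸ Γ → ℝ) (hf : Continuous f) (C : ℝ) (hC : ∀ x, |f x| ≤ C) (ε δ η : ℝ) (hδ : 0 < δ)
    (hw : ∀ w : SL(2, ℝ), |w.1 0 0 - 1| ≤ δ → |w.1 0 1| ≤ δ → |w.1 1 0| ≤ δ →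
      |w.1 1 1 - 1| ≤ δ → ∀ x, |f (w • x) - f x| ≤ ε / 2)
    (hη0 : 0 < η) (hη1 : η ≤ 1 / 8) (hη2 : η ≤ δ / 4)
    (w : SL(2, ℝ)) (hp : |w.1 0 0 - 1| ≤ η) (hr : |w.1 1 0| ≤ η)
    (t : ℝ) (ht : 0 ≤ t) (x : SL(2, ℝ) ⧸ Γ)
    (hq : |w.1 0 1| ≤ η) (hk : |w.1 1 1 - 1| ≤ η) (hη3 : 16 * C * η ≤ ε / 2) :
    |hueF f t (w • x) - hueF f t x| ≤ ε := by
  have hcv := hue_change_var (fun s => f (hueA t • horocycle s • x))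
    (hue_int_cont1 f hf t x) C
    (fun s => hC _) (w.1 0 0) (w.1 0 1) (w.1 1 0) (w.1 1 1) η
    (hue_det w) hη1 hp hq hr hk
  have hα0 := fun s hs => (hue_alpha w η hη1 hp hr s hs).2
  have hpt := hue_equi_pt f ε δ η hδ hw hη0 hη1 hη2 w hp hr t ht x
  have hint1 : IntervalIntegrable (fun s => f (hueA t • horocycle s • w • x)) volume 0 1 :=
    (hue_int_cont1 f hf t (w • x)).intervalIntegrable _ _
  have hint2 : IntervalIntegrable (fun s => f (hueA t • horocycle
      ((w.1 0 1 + s * w.1 1 1) / (w.1 0 0 + s * w.1 1 0)) • x)) volume 0 1 := by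
    apply ContinuousOn.intervalIntegrable
    rw [Set.uIcc_of_le zero_le_one]
    refine (hue_int_cont1 f hf t x).comp_continuousOn (s := Set.Icc (0:ℝ) 1)
      (f := fun s => (w.1 0 1 + s * w.1 1 1) / (w.1 0 0 + s * w.1 1 0)) ?_
    refine ContinuousOn.div (by fun_prop) (by fun_prop) fun s hs => ?_
    linarith [hα0 s hs]
  have h1 : |hueF f t (w • x) - ∫ s in (0:ℝ)..1, f (hueA t • horocycle
      ((w.1 0 1 + s * w.1 1 1) / (w.1 0 0 + s * w.1 1 0)) • x)| ≤ ε / 2 := by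
    unfold hueF
    rw [← intervalIntegral.integral_sub hint1 hint2]
    have := intervalIntegral.norm_integral_le_of_norm_le_const (a := (0:ℝ)) (b := 1) (C := ε / 2)
      (f := fun s => f (hueA t • horocycle s • w • x) -
      f (hueA t • horocycle ((w.1 0 1 + s * w.1 1 1) / (w.1 0 0 + s * w.1 1 0)) • x)) ?_
    · simpa using this
    · intro s hs
      rw [Set.uIoc_of_le zero_le_one] at hs
      exact hpt s ⟨hs.1.le, hs.2⟩
  have h2 := hcv.trans hη3
  have := abs_sub_le (hueF f t (w • x)) (∫ s in (0:ℝ)..1, f (hueA t • horocycle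
      ((w.1 0 1 + s * w.1 1 1) / (w.1 0 0 + s * w.1 1 0)) • x)) (hueF f t x)
  have h3 : |(∫ s in (0:ℝ)..1, f (hueA t • horocycle
      ((w.1 0 1 + s * w.1 1 1) / (w.1 0 0 + s * w.1 1 0)) • x)) - hueF f t x| ≤ ε / 2 := h2
  exact this.trans ((add_le_add h1 h3).trans (add_halves ε).le)


theorem hue_equi {Γ : Subgroup SL(2, ℝ)} [CompactSpace (SL(2, ℝ) ⧸ Γ)] (f : SL(2, ℝ) ⧸ Γ → ℝ)
    (hf : Continuous f) (C : ℝ) (hC : ∀ x, |f x| ≤ C) (ε : ℝ) (hε : 0 < ε) :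
    ∀ᶠ w : SL(2, ℝ) in nhds 1, ∀ t, 0 ≤ t → ∀ x, |hueF f t (w • x) - hueF f t x| ≤ ε := by
  obtain ⟨δ, hδ, hw⟩ := hue_unif_entries f hf (ε / 2) (half_pos hε)
  set C' := max C 1 with hC'
  have hC'1 : 1 ≤ C' := le_max_right _ _
  set η := min (min (1/8) (δ / 4)) (ε / (32 * C')) with hη
  have hη0 : 0 < η := by positivity
  have hη1 : η ≤ 1 / 8 := (min_le_left _ _).trans (min_le_left _ _)
  have hη2 : η ≤ δ / 4 := (min_le_left _ _).trans (min_le_right _ _)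
  have hη3 : 16 * C' * η ≤ ε / 2 := by
    have : η ≤ ε / (32 * C') := min_le_right _ _
    rw [le_div_iff₀ (by positivity)] at this
    linarith
  filter_upwards [hue_small_nhds η hη0] with w hw1 t ht x
  obtain ⟨hp, hq, hr, hk⟩ := hw1
  exact hue_equi_aux f hf C' (fun x => (hC x).trans (le_max_left _ _)) ε δ η hδ hw hη0 hη1 hη2 w hp hr
    t ht x hq hk hη3

theorem hue_U_neg (t : ℝ) : horocycle (-t) = (horocycle t)⁻¹ := by
  rw [eq_inv_iff_mul_eq_one, ← hue_U_add, neg_add_cancel, hue_U_zero]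

theorem hue_A_neg (t : ℝ) : hueA (-t) = (hueA t)⁻¹ := by
  rw [eq_inv_iff_mul_eq_one, ← hue_A_add, neg_add_cancel, hue_A_zero]

/-- invariance subgroup -/
def hueS {Γ : Subgroup SL(2, ℝ)} (φ : SL(2, ℝ) ⧸ Γ → ℝ) : Subgroup SL(2, ℝ) where
  carrier := {g | ∀ x, φ (g • x) = φ x}
  mul_mem' := by
    intro a b ha hb x
    rw [← smul_smul, ha, hb]
  one_mem' := by
    intro x
    rw [one_smul]
  inv_mem' := by
    intro a ha x
    have := ha (a⁻¹ • x)
    rw [smul_inv_smul] at this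
    exact this.symm

theorem hue_mem_S {Γ : Subgroup SL(2, ℝ)} {φ : SL(2, ℝ) ⧸ Γ → ℝ} {g : SL(2, ℝ)} :
    g ∈ hueS φ ↔ ∀ x, φ (g • x) = φ x := Iff.rfl

theorem hue_mautner {Γ : Subgroup SL(2, ℝ)} [CompactSpace (SL(2, ℝ) ⧸ Γ)]
    (φ : SL(2, ℝ) ⧸ Γ → ℝ) (hφ : Continuous φ) (h1 : ∀ x, φ (horocycle 1 • x) = φ x)
    (x y : SL(2, ℝ) ⧸ Γ) : φ x = φ y := by
  have hUn : ∀ n : ℕ, horocycle n ∈ hueS φ := by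
    intro n
    induction n with
    | zero => simpa [hue_U_zero] using (hueS φ).one_mem
    | succ n ih =>
      rw [Nat.cast_succ, hue_U_add]
      exact (hueS φ).mul_mem ih h1
  have hv : ∀ ε : ℝ, 0 < ε → ∃ δ : ℝ, 0 < δ ∧ ∀ r, |r| ≤ δ → ∀ x,
      |φ (hueV r • x) - φ x| ≤ ε ∧ |φ (horocycle r • x) - φ x| ≤ ε := by
    intro ε hε
    obtain ⟨δ, hδ, h⟩ := hue_unif_entries φ hφ ε hε
    refine ⟨δ, hδ, fun r hr x => ⟨h _ ?_ ?_ ?_ ?_ x, h _ ?_ ?_ ?_ ?_ x⟩⟩ <;> simp [hr, hδ.le]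
  have close : ∀ a b : ℝ, (∀ ε > 0, |a - b| ≤ ε) → a = b := by
    intro a b h
    by_contra hne
    have h0 : 0 < |a - b| := abs_pos.2 (sub_ne_zero.2 hne)
    have := h _ (half_pos h0)
    linarith
  have hA : hueA (Real.log 2) ∈ hueS φ := by
    intro x
    apply close
    intro ε hε
    obtain ⟨δ, hδ, h⟩ := hv (ε / 2) (half_pos hε)
    obtain ⟨k, hk⟩ := exists_nat_gt (1 / δ)
    have hk0 : (0:ℝ) < k := (by positivity : (0:ℝ) < 1 / δ).trans hk
    have hkδ : 1 / (k:ℝ) ≤ δ := by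
      rw [div_le_iff₀ hk0]
      rw [div_lt_iff₀ hδ] at hk
      linarith
    have hid : horocycle (2 * k) * (hueV (1 / (2 * k)) * horocycle (-k)) =
        hueV (1 / (4 * k)) * hueA (Real.log 2) := by
      apply hue_ext <;> simp [Real.exp_log]
      · field_simp; norm_num
      · field_simp; norm_num
      · field_simp; norm_num
      · field_simp; norm_num
    have hU2 : horocycle (2 * k) ∈ hueS φ := by
      have := hUn (2 * k)
      push_cast at this
      exact this
    have hUk : horocycle (-k) ∈ hueS φ := by
      rw [hue_U_neg]
      exact (hueS φ).inv_mem (hUn k)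
    have e1 := congrArg (fun g => φ (g • x)) hid
    simp only [← smul_smul] at e1
    rw [hU2] at e1
    have e2 := (h (1 / (2 * k)) (by
      rw [abs_of_pos (by positivity)]
      refine le_trans ?_ hkδ
      apply one_div_le_one_div_of_le hk0; linarith) (horocycle (-k) • x)).1
    rw [hUk x] at e2
    have e3 := (h (1 / (4 * k)) (by
      rw [abs_of_pos (by positivity)]
      refine le_trans ?_ hkδ
      apply one_div_le_one_div_of_le hk0; linarith) (hueA (Real.log 2) • x)).1
    rw [← e1] at e3
    rw [abs_le] at e2 e3 ⊢
    constructor <;> linarith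
  have hAn : ∀ n : ℕ, hueA (n * Real.log 2) ∈ hueS φ := by
    intro n
    induction n with
    | zero => simpa [hue_A_zero] using (hueS φ).one_mem
    | succ n ih =>
      rw [Nat.cast_succ, add_mul, one_mul, hue_A_add]
      exact (hueS φ).mul_mem ih hA
  have hexp : ∀ n : ℕ, Real.exp (-2 * (n * Real.log 2)) = (1 / 4) ^ n := by
    intro n
    have : -2 * (n * Real.log 2) = n * Real.log (1 / 4) := by
      rw [show (1 / 4 : ℝ) = (2 ^ 2)⁻¹ by norm_num, Real.log_inv, Real.log_pow]
      push_cast; ring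
    rw [this, Real.exp_nat_mul, Real.exp_log (by norm_num)]
  have hVs : ∀ s, hueV s ∈ hueS φ := by
    intro s x
    apply close
    intro ε hε
    obtain ⟨δ, hδ, h⟩ := hv ε hε
    obtain ⟨n, hn⟩ := exists_pow_lt_of_lt_one (show 0 < δ / (|s| + 1) by positivity)
      (show (1 / 4 : ℝ) < 1 by norm_num)
    rw [lt_div_iff₀ (by positivity)] at hn
    have hc := hue_A_B (n * Real.log 2) 1 s one_ne_zero
    rw [hexp n] at hc
    have e1 := congrArg (fun g => φ (g • x)) hc
    simp only [← smul_smul] at e1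
    rw [hAn n] at e1
    have e2 := (h ((1 / 4) ^ n * s) (by
      rw [abs_mul, abs_of_pos (by positivity)]
      have : (0:ℝ) < (1 / 4) ^ n := by positivity
      linarith) (hueA (n * Real.log 2) • x)).1
    rw [hAn n x] at e2
    have e3 : φ (hueV s • x) = φ (hueV ((1 / 4) ^ n * s) • hueA (n * Real.log 2) • x) := e1
    rw [e3]
    exact e2
  have hUd : ∀ n j : ℕ, horocycle ((1 / 4) ^ n * j) ∈ hueS φ := by
    intro n j
    have hc := hue_A_U (-(n * Real.log 2)) j
    rw [show 2 * (-(n * Real.log 2)) = -2 * (n * Real.log 2) by ring, hexp n] at hc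
    rw [← eq_mul_inv_iff_mul_eq] at hc
    have hm : hueA (-(n * Real.log 2)) ∈ hueS φ := by
      rw [hue_A_neg]
      exact (hueS φ).inv_mem (hAn n)
    have : horocycle ((1 / 4) ^ n * j) = hueA (-(n * Real.log 2)) * horocycle j *
        (hueA (-(n * Real.log 2)))⁻¹ := by
      rw [eq_mul_inv_iff_mul_eq]
      rw [eq_mul_inv_iff_mul_eq] at hc
      exact hc.symm
    rw [this]
    exact (hueS φ).mul_mem ((hueS φ).mul_mem hm (hUn j)) ((hueS φ).inv_mem hm)
  have hUpos : ∀ t : ℝ, 0 ≤ t → horocycle t ∈ hueS φ := by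
    intro t ht x
    apply close
    intro ε hε
    obtain ⟨δ, hδ, h⟩ := hv ε hε
    obtain ⟨n, hn⟩ := exists_pow_lt_of_lt_one hδ (show (1 / 4 : ℝ) < 1 by norm_num)
    have hp : (0:ℝ) < (1 / 4) ^ n := by positivity
    set j := Nat.floor (t / (1 / 4) ^ n) with hj
    have hj1 : (j:ℝ) ≤ t / (1 / 4) ^ n := Nat.floor_le (by positivity)
    have hj2 : t / (1 / 4) ^ n < j + 1 := Nat.lt_floor_add_one _
    rw [le_div_iff₀ hp] at hj1
    rw [div_lt_iff₀ hp] at hj2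
    have e := (h (t - (1 / 4) ^ n * j) (by
      rw [abs_of_nonneg (by linarith)]
      linarith) (horocycle ((1 / 4) ^ n * j) • x)).2
    rw [smul_smul, ← hue_U_add, sub_add_cancel, hUd n j x] at e
    exact e
  have hUt : ∀ t, horocycle t ∈ hueS φ := by
    intro t
    rcases le_total 0 t with ht | ht
    · exact hUpos t ht
    · rw [← neg_neg t, hue_U_neg]
      exact (hueS φ).inv_mem (hUpos _ (by linarith))
  have hall : ∀ g, g ∈ hueS φ := hue_gen (fun g => g ∈ hueS φ)
    (fun _ _ => (hueS φ).mul_mem) hUt hVs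
  obtain ⟨g, rfl⟩ := MulAction.exists_smul_eq SL(2, ℝ) x y
  exact (hall g x).symm

theorem hue_F_step {Γ : Subgroup SL(2, ℝ)} (f : SL(2, ℝ) ⧸ Γ → ℝ)
    (hf : Continuous f) (t : ℝ) (x : SL(2, ℝ) ⧸ Γ) :
    hueF f (t + Real.log 2 / 2) x = (hueF f t (hueA (Real.log 2 / 2) • x) +
      hueF f t (horocycle 1 • hueA (Real.log 2 / 2) • x)) / 2 := by
  set c := Real.log 2 / 2 with hc
  have hexp : Real.exp (2 * c) = 2 := by
    rw [hc, mul_div_cancel₀ _ (two_ne_zero), Real.exp_log two_pos]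
  have hψ : Continuous (fun s : ℝ => f (hueA (t + c) • horocycle s • x)) :=
    hue_int_cont1 f hf (t + c) x
  have hcomm : ∀ s, f (hueA t • horocycle s • hueA c • x) =
      f (hueA (t + c) • horocycle (s / 2) • x) := by
    intro s
    have h := hue_A_U c (s / 2)
    rw [hexp, mul_div_cancel₀ _ (two_ne_zero)] at h
    rw [smul_smul (horocycle s), ← h, hue_A_add, ← smul_smul, ← smul_smul]
  have h1 : hueF f t (hueA c • x) = 2 * ∫ s in (0:ℝ)..(1/2), f (hueA (t + c) • horocycle s • x) := by
    unfold hueF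
    simp only [hcomm]
    rw [intervalIntegral.integral_comp_div (fun s : ℝ => f (hueA (t + c) • horocycle s • x))
      two_ne_zero]
    simp
  have h2 : hueF f t (horocycle 1 • hueA c • x) =
      2 * ∫ s in (1/2:ℝ)..1, f (hueA (t + c) • horocycle s • x) := by
    unfold hueF
    have : ∀ s, f (hueA t • horocycle s • horocycle 1 • hueA c • x) =
        f (hueA (t + c) • horocycle (s / 2 + 1 / 2) • x) := by
      intro s
      rw [smul_smul (horocycle s), ← hue_U_add, hcomm, add_div]
    simp only [this]
    rw [intervalIntegral.integral_comp_div_add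
      (fun s : ℝ => f (hueA (t + c) • horocycle s • x)) two_ne_zero (1 / 2)]
    norm_num
  rw [h1, h2, ← mul_add, intervalIntegral.integral_add_adjacent_intervals
    (hψ.intervalIntegrable _ _) (hψ.intervalIntegrable _ _)]
  unfold hueF
  ring

theorem hue_F_bound {Γ : Subgroup SL(2, ℝ)} (f : SL(2, ℝ) ⧸ Γ → ℝ)
    (C : ℝ) (hC : ∀ x, |f x| ≤ C) (t : ℝ) (x : SL(2, ℝ) ⧸ Γ) : |hueF f t x| ≤ C := by
  have := intervalIntegral.norm_integral_le_of_norm_le_const (a := (0:ℝ)) (b := 1) (C := C)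
      (f := fun s => f (hueA t • horocycle s • x)) (fun s _ => hC _)
  unfold hueF
  simpa using this

theorem hue_integrable {X : Type*} [TopologicalSpace X] [CompactSpace X] [MeasurableSpace X]
    [BorelSpace X] (m : Measure X) [IsFiniteMeasure m] (F : X → ℝ) (hF : Continuous F) :
    Integrable F m :=
  hF.integrable_of_hasCompactSupport (HasCompactSupport.of_compactSpace F)

theorem hue_int_inv {X : Type*} [TopologicalSpace X] [MeasurableSpace X]
    [BorelSpace X] (m : Measure X) (T : X → X) (hT : MeasurePreserving T m m)
    (F : X → ℝ) (hF : Continuous F) : ∫ x, F (T x) ∂m = ∫ x, F x ∂m := by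
  conv_rhs => rw [← hT.map_eq]
  rw [integral_map hT.measurable.aemeasurable hF.aestronglyMeasurable]

theorem hue_L2_step {Γ : Subgroup SL(2, ℝ)} [CompactSpace (SL(2, ℝ) ⧸ Γ)]
    [BorelSpace (SL(2, ℝ) ⧸ Γ)] (m : Measure (SL(2, ℝ) ⧸ Γ)) [IsFiniteMeasure m]
    (hm : ∀ g : SL(2, ℝ), MeasurePreserving (fun x : SL(2, ℝ) ⧸ Γ => g • x) m m)
    (f : SL(2, ℝ) ⧸ Γ → ℝ) (hf : Continuous f) (t : ℝ) :
    ∫ x, (hueF f (t + Real.log 2 / 2) x) ^ 2 ∂m = ∫ x, (hueF f t x) ^ 2 ∂m -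
      (∫ x, (hueF f t (horocycle 1 • x) - hueF f t x) ^ 2 ∂m) / 4 := by
  have hF := hue_F_cont f hf t
  set F := hueF f t with hFdef
  have hc : ∀ g : SL(2, ℝ), Continuous (fun x : SL(2, ℝ) ⧸ Γ => F (g • x)) := fun g =>
    hF.comp (continuous_const_smul g)
  set G : SL(2, ℝ) ⧸ Γ → ℝ := fun y => ((F y + F (horocycle 1 • y)) / 2) ^ 2 with hG
  have hGc : Continuous G := by
    have := hc (horocycle 1)
    fun_prop
  have h1 : ∫ x, (hueF f (t + Real.log 2 / 2) x) ^ 2 ∂m = ∫ x, G x ∂m := by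
    rw [← hue_int_inv m _ (hm (hueA (Real.log 2 / 2))) G hGc]
    congr 1
    ext x
    rw [hue_F_step f hf]
  have h2 : ∀ x, G x = ((F x) ^ 2 / 2 + (F (horocycle 1 • x)) ^ 2 / 2) -
      (F (horocycle 1 • x) - F x) ^ 2 / 4 := by
    intro x; simp only [hG]; ring
  have i1 : Integrable (fun x => (F x) ^ 2 / 2) m := hue_integrable m _ (by fun_prop)
  have i2 : Integrable (fun x => (F (horocycle 1 • x)) ^ 2 / 2) m := hue_integrable m _ (by
    have := hc (horocycle 1)
    fun_prop)
  have i3 : Integrable (fun x => (F (horocycle 1 • x) - F x) ^ 2 / 4) m := hue_integrable m _ (by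
    have := hc (horocycle 1)
    fun_prop)
  rw [h1]
  simp only [h2]
  have i12 : Integrable (fun x => (F x) ^ 2 / 2 + (F (horocycle 1 • x)) ^ 2 / 2) m := i1.add i2
  rw [integral_sub i12 i3, integral_add i1 i2, integral_div, integral_div, integral_div,
    hue_int_inv m _ (hm (horocycle 1)) (fun x => F x ^ 2) (by fun_prop)]
  ring

theorem hue_d_tendsto {Γ : Subgroup SL(2, ℝ)} [CompactSpace (SL(2, ℝ) ⧸ Γ)]
    [BorelSpace (SL(2, ℝ) ⧸ Γ)] (m : Measure (SL(2, ℝ) ⧸ Γ)) [IsFiniteMeasure m]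
    (hm : ∀ g : SL(2, ℝ), MeasurePreserving (fun x : SL(2, ℝ) ⧸ Γ => g • x) m m)
    (f : SL(2, ℝ) ⧸ Γ → ℝ) (hf : Continuous f) :
    Tendsto (fun n : ℕ => ∫ x, (hueF f (n * (Real.log 2 / 2)) (horocycle 1 • x) -
      hueF f (n * (Real.log 2 / 2)) x) ^ 2 ∂m) atTop (nhds 0) := by
  set a : ℕ → ℝ := fun n => ∫ x, (hueF f (n * (Real.log 2 / 2)) x) ^ 2 ∂m with ha
  set d : ℕ → ℝ := fun n => ∫ x, (hueF f (n * (Real.log 2 / 2)) (horocycle 1 • x) -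
      hueF f (n * (Real.log 2 / 2)) x) ^ 2 ∂m with hd
  have hstep : ∀ n, a (n + 1) = a n - d n / 4 := by
    intro n
    have := hue_L2_step m hm f hf (n * (Real.log 2 / 2))
    simp only [ha, hd]
    rw [← this, Nat.cast_succ, add_mul, one_mul]
  have hd0 : ∀ n, 0 ≤ d n := fun n => integral_nonneg fun x => sq_nonneg _
  have ha0 : ∀ n, 0 ≤ a n := fun n => integral_nonneg fun x => sq_nonneg _
  have hanti : Antitone a := antitone_nat_of_succ_le fun n => by linarith [hstep n, hd0 n]
  have hlim := tendsto_atTop_ciInf hanti ⟨0, by rintro _ ⟨n, rfl⟩; exact ha0 n⟩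
  have hlim' := (tendsto_add_atTop_iff_nat 1).2 hlim
  have := (hlim.sub hlim').const_mul 4
  rw [sub_self, mul_zero] at this
  refine this.congr fun n => ?_
  rw [hstep n]; ring

theorem hue_equicont {Γ : Subgroup SL(2, ℝ)} [CompactSpace (SL(2, ℝ) ⧸ Γ)]
    (f : SL(2, ℝ) ⧸ Γ → ℝ) (hf : Continuous f) (C : ℝ) (hC : ∀ x, |f x| ≤ C)
    (x : SL(2, ℝ) ⧸ Γ) (ε : ℝ) (hε : 0 < ε) :
    ∀ᶠ y in nhds x, ∀ t, 0 ≤ t → |hueF f t y - hueF f t x| ≤ ε := by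
  obtain ⟨g, rfl⟩ := QuotientGroup.mk_surjective x
  rw [QuotientGroup.nhds_eq, eventually_map]
  have h := hue_equi f hf C hC ε hε
  have ht : Tendsto (fun h : SL(2, ℝ) => h * g⁻¹) (nhds g) (nhds 1) := by
    have : Continuous (fun h : SL(2, ℝ) => h * g⁻¹) := by fun_prop
    simpa using this.tendsto g
  filter_upwards [ht.eventually h] with k hk t ht
  have := hk t ht (QuotientGroup.mk g)
  have e : (k * g⁻¹) • (QuotientGroup.mk g : SL(2, ℝ) ⧸ Γ) = QuotientGroup.mk k := by
    change QuotientGroup.mk (k * g⁻¹ * g) = _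
    rw [inv_mul_cancel_right]
  rwa [e] at this

open BoundedContinuousFunction in
theorem hue_const {Γ : Subgroup SL(2, ℝ)} [DiscreteTopology Γ] [CompactSpace (SL(2, ℝ) ⧸ Γ)]
    [BorelSpace (SL(2, ℝ) ⧸ Γ)] (f : SL(2, ℝ) ⧸ Γ → ℝ) (hf : Continuous f)
    (C : ℝ) (hC : ∀ x, |f x| ≤ C) :
    ∃ c : ℝ, ∀ ε > 0, ∃ t : ℝ, ∀ x, |hueF f t x - c| ≤ ε := by
  have := hue_haar_right
  obtain ⟨m, hm1, hm2, hm⟩ := hue_exists_inv_measure Γ (Measure.haar : Measure SL(2, ℝ))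
  let τ : ℕ → ℝ := fun n => n * (Real.log 2 / 2)
  have hτ : ∀ n, 0 ≤ τ n := fun n => by
    have := Real.log_nonneg (one_le_two (α := ℝ))
    positivity
  let Fb : ℕ → (SL(2, ℝ) ⧸ Γ) →ᵇ ℝ := fun n => mkOfCompact ⟨hueF f (τ n), hue_F_cont f hf (τ n)⟩
  have hFb : ∀ n x, Fb n x = hueF f (τ n) x := fun n x => rfl
  have hcomp : IsCompact (closure (Set.range Fb)) := by
    apply arzela_ascoli (Set.Icc (-C) C) isCompact_Icc
    · rintro _ x ⟨n, rfl⟩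
      exact abs_le.1 (hue_F_bound f C hC (τ n) x)
    · intro x
      rw [Metric.equicontinuousAt_iff_right]
      intro ε hε
      filter_upwards [hue_equicont f hf C hC x (ε / 2) (half_pos hε)] with y hy
      rintro ⟨_, n, rfl⟩
      rw [dist_comm, Real.dist_eq]
      exact (hy (τ n) (hτ n)).trans_lt (half_lt_self hε)
  obtain ⟨F, -, φ, hφ, hF⟩ := hcomp.tendsto_subseq (x := Fb) fun n => subset_closure ⟨n, rfl⟩
  have hunif : ∀ ε > 0, ∃ N, ∀ k ≥ N, ∀ x, |hueF f (τ (φ k)) x - F x| ≤ ε := by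
    intro ε hε
    obtain ⟨N, hN⟩ := Metric.tendsto_atTop.1 hF ε hε
    refine ⟨N, fun k hk x => ?_⟩
    have := (dist_coe_le_dist x).trans (hN k hk).le
    rwa [Real.dist_eq] at this
  have hpt : ∀ x, Tendsto (fun k => hueF f (τ (φ k)) x) atTop (nhds (F x)) := by
    intro x
    rw [Metric.tendsto_atTop]
    intro ε hε
    obtain ⟨N, hN⟩ := hunif (ε / 2) (half_pos hε)
    exact ⟨N, fun k hk => (Real.dist_eq _ _).trans_lt ((hN k hk x).trans_lt (half_lt_self hε))⟩
  have hFu : Continuous (fun x => (F (horocycle 1 • x) - F x) ^ 2) := by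
    have := F.continuous
    fun_prop
  have hlim1 : Tendsto (fun k => ∫ x, (hueF f (τ (φ k)) (horocycle 1 • x) -
      hueF f (τ (φ k)) x) ^ 2 ∂m) atTop (nhds (∫ x, (F (horocycle 1 • x) - F x) ^ 2 ∂m)) := by
    apply tendsto_integral_of_dominated_convergence (fun _ => (2 * C) ^ 2)
    · intro k
      have := hue_F_cont f hf (τ (φ k))
      exact Continuous.aestronglyMeasurable (by fun_prop)
    · exact integrable_const _
    · intro k
      refine Eventually.of_forall fun x => ?_
      rw [Real.norm_eq_abs, abs_pow]
      have h1 := hue_F_bound f C hC (τ (φ k)) (horocycle 1 • x)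
      have h2 := hue_F_bound f C hC (τ (φ k)) x
      refine pow_le_pow_left₀ (abs_nonneg _) ?_ 2
      exact (abs_sub _ _).trans (by linarith)
    · refine Eventually.of_forall fun x => ?_
      exact ((hpt _).sub (hpt x)).pow 2
  have hlim2 := (hue_d_tendsto m hm f hf).comp hφ.tendsto_atTop
  have h0 : ∫ x, (F (horocycle 1 • x) - F x) ^ 2 ∂m = 0 := tendsto_nhds_unique hlim1 hlim2
  rw [integral_eq_zero_iff_of_nonneg (fun x => sq_nonneg _) (hue_integrable m _ hFu)] at h0
  have h0' := (hFu.ae_eq_iff_eq m continuous_zero).1 h0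
  have hinv : ∀ x, F (horocycle 1 • x) = F x := by
    intro x
    have := congrFun h0' x
    simp only [Pi.zero_apply] at this
    exact sub_eq_zero.1 (pow_eq_zero_iff two_ne_zero |>.1 this)
  have hcst := hue_mautner F F.continuous hinv
  refine ⟨F (QuotientGroup.mk 1), fun ε hε => ?_⟩
  obtain ⟨N, hN⟩ := hunif ε hε
  refine ⟨τ (φ N), fun x => ?_⟩
  rw [hcst (QuotientGroup.mk 1) x]
  exact hN N le_rfl x

theorem hue_avg {Γ : Subgroup SL(2, ℝ)} [CompactSpace (SL(2, ℝ) ⧸ Γ)]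
    [BorelSpace (SL(2, ℝ) ⧸ Γ)] (μ : Measure (SL(2, ℝ) ⧸ Γ)) [IsProbabilityMeasure μ]
    (hμ : ∀ t : ℝ, MeasurePreserving (fun x : SL(2, ℝ) ⧸ Γ => horocycle t • x) μ μ)
    (f : SL(2, ℝ) ⧸ Γ → ℝ) (hf : Continuous f) (C : ℝ) (hC : ∀ x, |f x| ≤ C) (t : ℝ) :
    ∫ x, hueF f t (hueA (-t) • x) ∂μ = ∫ x, f x ∂μ := by
  have h1 : ∀ x : SL(2, ℝ) ⧸ Γ, hueF f t (hueA (-t) • x) =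
      ∫ s in (0:ℝ)..1, f (horocycle (Real.exp (2 * t) * s) • x) := by
    intro x
    unfold hueF
    congr 1
    ext s
    rw [smul_smul (hueA t), hue_A_U, ← smul_smul, smul_smul (hueA t), ← hue_A_add, add_neg_cancel,
      hue_A_zero, one_smul]
  simp only [h1]
  have hc : Continuous (Function.uncurry fun (s : ℝ) (x : SL(2, ℝ) ⧸ Γ) =>
      f (horocycle (Real.exp (2 * t) * s) • x)) := by
    have := hue_U_cont
    unfold Function.uncurry
    fun_prop
  rw [← intervalIntegral_integral_swap]
  · have : ∀ s : ℝ, ∫ x, f (horocycle (Real.exp (2 * t) * s) • x) ∂μ = ∫ x, f x ∂μ := fun s =>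
      hue_int_inv μ _ (hμ _) f hf
    simp [this]
  · have hsc : SecondCountableTopology (SL(2, ℝ) ⧸ Γ) := inferInstance
    have hfin : IsFiniteMeasure ((volume : Measure ℝ).restrict (Set.uIoc 0 1)) := by
      rw [Set.uIoc_of_le zero_le_one]
      infer_instance
    exact Integrable.of_bound hc.aestronglyMeasurable C (Eventually.of_forall fun z => hC _)

theorem hue_int_eq {Γ : Subgroup SL(2, ℝ)} [CompactSpace (SL(2, ℝ) ⧸ Γ)]
    [BorelSpace (SL(2, ℝ) ⧸ Γ)] (μ : Measure (SL(2, ℝ) ⧸ Γ)) [IsProbabilityMeasure μ]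
    (hμ : ∀ t : ℝ, MeasurePreserving (fun x : SL(2, ℝ) ⧸ Γ => horocycle t • x) μ μ)
    (f : SL(2, ℝ) ⧸ Γ → ℝ) (hf : Continuous f) (C : ℝ) (hC : ∀ x, |f x| ≤ C) (c : ℝ)
    (hc : ∀ ε > 0, ∃ t : ℝ, ∀ x, |hueF f t x - c| ≤ ε) : ∫ x, f x ∂μ = c := by
  have key : ∀ ε > 0, |∫ x, f x ∂μ - c| ≤ ε := by
    intro ε hε
    obtain ⟨t, ht⟩ := hc ε hε
    rw [← hue_avg μ hμ f hf C hC t]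
    have hi : Integrable (fun x => hueF f t (hueA (-t) • x)) μ :=
      hue_integrable μ _ ((hue_F_cont f hf t).comp (continuous_const_smul _))
    have e : ∫ x, hueF f t (hueA (-t) • x) ∂μ - c = ∫ x, (hueF f t (hueA (-t) • x) - c) ∂μ := by
      rw [integral_sub hi (integrable_const c)]
      simp
    rw [e]
    have := norm_integral_le_of_norm_le_const (μ := μ) (C := ε)
      (f := fun x => hueF f t (hueA (-t) • x) - c) (Eventually.of_forall fun x => ht _)
    simpa using this
  by_contra hne
  have h0 : 0 < |∫ x, f x ∂μ - c| := abs_pos.2 (sub_ne_zero.2 hne)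
  have := key _ (half_pos h0)
  linarith

/-- **Furstenberg**: the horocycle flow on a compact quotient `SL(2,ℝ)/Γ` is uniquely
ergodic: any two invariant Borel probability measures coincide. -/
theorem horocycle_uniquely_ergodic (Γ : Subgroup (SL(2, ℝ))) [DiscreteTopology Γ]
    [CompactSpace (SL(2, ℝ) ⧸ Γ)] [BorelSpace (SL(2, ℝ) ⧸ Γ)]
    (μ ν : Measure (SL(2, ℝ) ⧸ Γ)) [IsProbabilityMeasure μ] [IsProbabilityMeasure ν]
    (hμ : ∀ t : ℝ, MeasurePreserving (fun x : SL(2, ℝ) ⧸ Γ => horocycle t • x) μ μ)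
    (hν : ∀ t : ℝ, MeasurePreserving (fun x : SL(2, ℝ) ⧸ Γ => horocycle t • x) ν ν) :
    μ = ν := by
  have hcl : IsClosed (Γ : Set SL(2, ℝ)) := Subgroup.isClosed_of_discrete
  have ht2 : T2Space (SL(2, ℝ) ⧸ Γ) := inferInstance
  have hsc : SecondCountableTopology (SL(2, ℝ) ⧸ Γ) := inferInstance
  have hmet : TopologicalSpace.PseudoMetrizableSpace (SL(2, ℝ) ⧸ Γ) := inferInstance
  apply ext_of_forall_integral_eq_of_IsFiniteMeasure
  intro f
  have hC : ∀ x, |f x| ≤ ‖f‖ := fun x => f.norm_coe_le_norm x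
  obtain ⟨c, hc⟩ := hue_const f f.continuous ‖f‖ hC
  rw [hue_int_eq μ hμ f f.continuous ‖f‖ hC c hc, hue_int_eq ν hν f f.continuous ‖f‖ hC c hc]
end
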